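/- Let 1 < p < 2, let N ≥ n ≥ 2, let τ be a probability measure on N̄ = {1,…,N}, and let X be an n-dimensional subspace of L_p(N̄, τ). Then there exist an integer M with N ≤ M ≤ (3/2)N, a probability measure ν on M̄ = {1,…,M}, a partition {σ_1,…,σ_N} of M̄ with Σ_{i∈σ_j} ν{i} = τ{j} for each j, and a partition M̄ = M_1 ∪ M_2 into two sets each of cardinality at most (7/8)N, such that, with Y = J_p X, for every y ∈ Y and j = 1, 2: ‖1_{M_j} y‖_{L_p(M̄,ν)}^p ≤ (1/2 + C (p−1)^{(p−2)/4} (n/N)^{1/2} (log n)^{(6−p)/4} (log N)^{p/4}) ‖y‖_{L_p(M̄,ν)}^p, where C is an absolute constant. -/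

import Mathlib

open scoped BigOperators

namespace PartitionBound

open MeasureTheory Finset

/-- The unnormalised Gaussian weight `exp (-‖x‖² / 2)`. -/
noncomputable def gaussWeight {E : Type*} [Norm E] (x : E) : ℝ := Real.exp (-‖x‖ ^ 2 / 2)

lemma gaussWeight_pos {E : Type*} [Norm E] (x : E) : 0 < gaussWeight x := Real.exp_pos _

local notation "⟪" x "," y "⟫" => inner ℝ x y

section Gaussian

lemma exp_inner_mul_gaussWeight {E : Type*} [NormedAddCommGroup E] [InnerProductSpace ℝ E]
    (a x : E) :
    Real.exp ⟪a, x⟫ * gaussWeight x = Real.exp (‖a‖ ^ 2 / 2) * gaussWeight (x - a) := by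
  unfold gaussWeight
  rw [← Real.exp_add, ← Real.exp_add, norm_sub_sq_real, real_inner_comm]
  congr 1
  ring

variable {E : Type*} [NormedAddCommGroup E] [InnerProductSpace ℝ E] [FiniteDimensional ℝ E]
  [MeasurableSpace E] [BorelSpace E]

lemma integrable_gaussWeight : Integrable (gaussWeight : E → ℝ) := by
  have h := (GaussianFourier.integrable_cexp_neg_mul_sq_norm_add (V := E) (b := 1 / 2)
    (by norm_num) 0 0).norm
  refine h.congr (Filter.Eventually.of_forall fun x => ?_)
  have : (-(1 / 2 : ℂ) * (‖x‖ : ℂ) ^ 2 + 0 * ((⟪(0 : E), x⟫ : ℝ) : ℂ))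
      = ((-‖x‖ ^ 2 / 2 : ℝ) : ℂ) := by push_cast; ring
  simp only [this, Complex.norm_exp, Complex.ofReal_re, gaussWeight]

lemma integrable_exp_inner_mul_gaussWeight (a : E) :
    Integrable fun x : E => Real.exp ⟪a, x⟫ * gaussWeight x := by
  simp_rw [exp_inner_mul_gaussWeight]
  exact (integrable_gaussWeight.comp_sub_right a).const_mul _

lemma integral_exp_inner_mul_gaussWeight (a : E) :
    ∫ x : E, Real.exp ⟪a, x⟫ * gaussWeight x
      = Real.exp (‖a‖ ^ 2 / 2) * ∫ x : E, gaussWeight x := by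
  simp_rw [exp_inner_mul_gaussWeight]
  rw [integral_const_mul, integral_sub_right_eq_self]

lemma integral_gaussWeight_pos : 0 < ∫ x : E, gaussWeight x := by
  rw [integral_pos_iff_support_of_nonneg (fun x => (gaussWeight_pos x).le) integrable_gaussWeight]
  have : Function.support (gaussWeight : E → ℝ) = Set.univ :=
    Set.eq_univ_of_forall fun x => (gaussWeight_pos x).ne'
  rw [this]
  exact isOpen_univ.measure_pos _ Set.univ_nonempty

lemma pow_le_factorial_mul_exp_add_exp_neg (x : ℝ) (m : ℕ) :
    x ^ (2 * m) ≤ ((2 * m).factorial : ℝ) * (Real.exp x + Real.exp (-x)) := by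
  have h := Real.pow_div_factorial_le_exp |x| (abs_nonneg x) (2 * m)
  rw [div_le_iff₀ (by positivity), (even_two_mul m).pow_abs] at h
  have h2 : Real.exp |x| ≤ Real.exp x + Real.exp (-x) := by
    rcases abs_cases x with ⟨h, -⟩ | ⟨h, -⟩ <;> rw [h] <;>
      linarith [Real.exp_pos x, Real.exp_pos (-x)]
  nlinarith [show (0 : ℝ) < ((2 * m).factorial : ℝ) by positivity]

lemma integrable_inner_pow_mul_gaussWeight (u : E) (m : ℕ) :
    Integrable fun x : E => ⟪u, x⟫ ^ (2 * m) * gaussWeight x := by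
  have h := ((integrable_exp_inner_mul_gaussWeight u).add
    (integrable_exp_inner_mul_gaussWeight (-u))).const_mul ((2 * m).factorial : ℝ)
  refine h.mono' ?_ (Filter.Eventually.of_forall fun x => ?_)
  · unfold gaussWeight
    fun_prop
  · have hp := (gaussWeight_pos x).le
    rw [Real.norm_of_nonneg (mul_nonneg ((even_two_mul m).pow_nonneg _) hp)]
    have := mul_le_mul_of_nonneg_right (pow_le_factorial_mul_exp_add_exp_neg ⟪u, x⟫ m) hp
    simp only [Pi.add_apply, inner_neg_left]
    linarith

/-- Even moments of a linear functional under the Gaussian weight. -/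
lemma integral_inner_pow_mul_gaussWeight_le {u : E} {m : ℕ} (hm : 0 < m) {n : ℝ} (hn : 0 < n)
    (hu : ‖u‖ ^ 2 ≤ n) :
    ∫ x : E, ⟪u, x⟫ ^ (2 * m) * gaussWeight x
      ≤ 2 * (6 * m * n) ^ m * ∫ x : E, gaussWeight x := by
  set G := ∫ x : E, gaussWeight x
  have hG : 0 < G := integral_gaussWeight_pos
  have hm' : (0 : ℝ) < m := by exact_mod_cast hm
  set s : ℝ := Real.sqrt (2 * m / n) with hs
  have hs2 : s ^ 2 = 2 * m / n := Real.sq_sqrt (by positivity)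
  have hspos : 0 < s := Real.sqrt_pos.2 (by positivity)
  have key : s ^ (2 * m) * ∫ x : E, ⟪u, x⟫ ^ (2 * m) * gaussWeight x
      ≤ ((2 * m).factorial : ℝ) * (2 * Real.exp m * G) := by
    have hle : ∫ x : E, s ^ (2 * m) * (⟪u, x⟫ ^ (2 * m) * gaussWeight x) ≤
        ∫ x : E, ((2 * m).factorial : ℝ) * (Real.exp ⟪s • u, x⟫ * gaussWeight x +
          Real.exp ⟪-(s • u), x⟫ * gaussWeight x) := by
      refine integral_mono ((integrable_inner_pow_mul_gaussWeight u m).const_mul _)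
        (((integrable_exp_inner_mul_gaussWeight _).add
          (integrable_exp_inner_mul_gaussWeight _)).const_mul _) fun x => ?_
      have := mul_le_mul_of_nonneg_right (pow_le_factorial_mul_exp_add_exp_neg (s * ⟪u, x⟫) m)
        (gaussWeight_pos x).le
      simp only [inner_neg_left, real_inner_smul_left]
      rw [mul_pow] at this
      linarith
    rw [integral_const_mul, integral_const_mul, integral_add
      (integrable_exp_inner_mul_gaussWeight _) (integrable_exp_inner_mul_gaussWeight _),
      integral_exp_inner_mul_gaussWeight, integral_exp_inner_mul_gaussWeight, norm_neg] at hle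
    have hexp : Real.exp (‖s • u‖ ^ 2 / 2) ≤ Real.exp m := by
      apply Real.exp_le_exp.2
      rw [norm_smul, mul_pow, Real.norm_eq_abs, sq_abs, hs2]
      calc 2 * m / n * ‖u‖ ^ 2 / 2 ≤ 2 * m / n * n / 2 := by gcongr
        _ = m := by field_simp
    refine hle.trans (mul_le_mul_of_nonneg_left ?_ (by positivity))
    nlinarith
  have hfac : ((2 * m).factorial : ℝ) ≤ (2 * m : ℝ) ^ (2 * m) := by
    exact_mod_cast Nat.factorial_le_pow (2 * m)
  have hexp : Real.exp m ≤ 3 ^ m := by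
    rw [← Real.exp_one_pow]
    gcongr
    linarith [Real.exp_one_lt_d9]
  rw [pow_mul, hs2] at key
  have h1 : ((2 * m).factorial : ℝ) * (2 * Real.exp m * G)
      ≤ (2 * m : ℝ) ^ (2 * m) * (2 * 3 ^ m * G) := by gcongr
  have h2 : (2 * m : ℝ) ^ (2 * m) * (2 * 3 ^ m * G)
      = (2 * m / n) ^ m * (2 * (6 * m * n) ^ m * G) := by
    have : (2 * m : ℝ) ^ (2 * m) * 3 ^ m = (2 * m / n) ^ m * (6 * m * n) ^ m := by
      rw [pow_mul, ← mul_pow, ← mul_pow]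
      congr 1
      field_simp
      ring
    linear_combination (2 * G) * this
  exact le_of_mul_le_mul_left ((key.trans h1).trans_eq h2) (by positivity)

lemma exp_mul_setIntegral_gaussWeight_le {K : Set E} (hK : MeasurableSet K)
    (hsymm : ∀ x, -x ∈ K ↔ x ∈ K) (a : E) :
    Real.exp (-‖a‖ ^ 2 / 2) * ∫ x in K, gaussWeight x
      ≤ ∫ x in (fun x => x - a) ⁻¹' K, gaussWeight x := by
  have hshift : ∀ b : E, ∫ x in (fun x => x - b) ⁻¹' K, gaussWeight x
      = ∫ x in K, gaussWeight (x + b) := by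
    intro b
    rw [← integral_indicator ((measurable_sub_const b) hK), ← integral_indicator hK,
      ← integral_sub_right_eq_self (K.indicator fun x => gaussWeight (x + b)) b]
    congr 1 with x
    by_cases hx : x - b ∈ K <;> simp [Set.indicator, hx]
  have hneg : ∫ x in K, gaussWeight (x + a) = ∫ x in K, gaussWeight (x - a) := by
    rw [← integral_indicator hK, ← integral_indicator hK,
      ← integral_neg_eq_self (K.indicator fun x => gaussWeight (x + a))]
    congr 1 with x
    have : gaussWeight (-x + a) = gaussWeight (x - a) := by
      unfold gaussWeight
      rw [← norm_neg (-x + a), show -(-x + a) = x - a by abel]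
    by_cases hx : x ∈ K
    · simp [Set.indicator, hx, (hsymm x).2 hx, this]
    · simp [Set.indicator, hx, mt (hsymm x).1 hx]
  have hadd : ∀ x : E, Real.exp (-‖a‖ ^ 2 / 2) * gaussWeight x
      ≤ (gaussWeight (x + a) + gaussWeight (x - a)) / 2 := by
    intro x
    have h1 := exp_inner_mul_gaussWeight a x
    have h2 := exp_inner_mul_gaussWeight (-a) x
    rw [norm_neg, sub_neg_eq_add, inner_neg_left] at h2
    have h3 : Real.exp (-‖a‖ ^ 2 / 2) * Real.exp (‖a‖ ^ 2 / 2) = 1 := by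
      rw [← Real.exp_add, ← Real.exp_zero]; congr 1; ring
    have h4 : 1 ≤ (Real.exp ⟪a, x⟫ + Real.exp (-⟪a, x⟫)) / 2 := by
      rw [← Real.cosh_eq]; exact Real.one_le_cosh _
    have h5 : gaussWeight (x + a) + gaussWeight (x - a) = Real.exp (-‖a‖ ^ 2 / 2) *
        ((Real.exp ⟪a, x⟫ + Real.exp (-⟪a, x⟫)) * gaussWeight x) := by
      linear_combination (-(gaussWeight (x + a) + gaussWeight (x - a))) * h3
        - Real.exp (-‖a‖ ^ 2 / 2) * (h1 + h2)
    rw [h5]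
    have := mul_pos (Real.exp_pos (-‖a‖ ^ 2 / 2)) (gaussWeight_pos x)
    nlinarith
  have hi1 : Integrable fun x : E => gaussWeight (x + a) := integrable_gaussWeight.comp_add_right a
  have hi2 : Integrable fun x : E => gaussWeight (x - a) := integrable_gaussWeight.comp_sub_right a
  calc Real.exp (-‖a‖ ^ 2 / 2) * ∫ x in K, gaussWeight x
      = ∫ x in K, Real.exp (-‖a‖ ^ 2 / 2) * gaussWeight x := (integral_const_mul _ _).symm
    _ ≤ ∫ x in K, (gaussWeight (x + a) + gaussWeight (x - a)) / 2 :=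
        setIntegral_mono (integrable_gaussWeight.const_mul _).integrableOn
          ((hi1.add hi2).div_const 2).integrableOn hadd
    _ = ∫ x in K, gaussWeight (x + a) := by
        rw [integral_div, integral_add hi1.integrableOn hi2.integrableOn, ← hneg]; ring
    _ = _ := (hshift a).symm

/-- Packing bound: if translates of a symmetric set carrying half of the Gaussian mass by points
of norm at most `R` are disjoint, there are at most `2 exp (R² / 2)` of them. -/
lemma card_le_of_disjoint_translates {K : Set E} (hK : MeasurableSet K)
    (hsymm : ∀ x, -x ∈ K ↔ x ∈ K) (hhalf : (∫ x : E, gaussWeight x) / 2 ≤ ∫ x in K, gaussWeight x)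
    {S : Finset E} {R : ℝ} (hS : ∀ a ∈ S, ‖a‖ ^ 2 ≤ R)
    (hdisj : ∀ a ∈ S, ∀ b ∈ S, a ≠ b → ∀ x, x - a ∈ K → x - b ∉ K) :
    (S.card : ℝ) ≤ 2 * Real.exp (R / 2) := by
  set G := ∫ x : E, gaussWeight x
  have hG : 0 < G := integral_gaussWeight_pos
  have hsum : ∑ a ∈ S, ∫ x in (fun x => x - a) ⁻¹' K, gaussWeight x ≤ G := by
    rw [← integral_biUnion_finset S (fun a _ => (measurable_sub_const a) hK) ?_
      (fun a _ => integrable_gaussWeight.integrableOn)]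
    · exact setIntegral_le_integral integrable_gaussWeight
        (Filter.Eventually.of_forall fun x => (gaussWeight_pos x).le)
    · intro a ha b hb hab
      exact Set.disjoint_left.2 fun x hx => hdisj a ha b hb hab x hx
  have hlow : ∀ a ∈ S, Real.exp (-R / 2) * (G / 2)
      ≤ ∫ x in (fun x => x - a) ⁻¹' K, gaussWeight x := by
    intro a ha
    refine le_trans ?_ (exp_mul_setIntegral_gaussWeight_le hK hsymm a)
    have : Real.exp (-R / 2) ≤ Real.exp (-‖a‖ ^ 2 / 2) :=
      Real.exp_le_exp.2 (by linarith [hS a ha])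
    gcongr
  have h := (Finset.card_nsmul_le_sum S _ _ hlow).trans hsum
  rw [nsmul_eq_mul] at h
  have h3 : Real.exp (-R / 2) * Real.exp (R / 2) = 1 := by
    rw [← Real.exp_add, ← Real.exp_zero]; congr 1; ring
  have h4 : ((S.card : ℝ) * Real.exp (-R / 2)) * (G / 2) ≤ 2 * (G / 2) := by linarith
  have h5 := le_of_mul_le_mul_right h4 (by positivity)
  calc (S.card : ℝ) = (S.card : ℝ) * Real.exp (-R / 2) * Real.exp (R / 2) := by
        rw [mul_assoc, h3, mul_one]
    _ ≤ 2 * Real.exp (R / 2) := by gcongr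

end Gaussian

section Moments

variable {E : Type*} [NormedAddCommGroup E] [InnerProductSpace ℝ E]
  {ι : Type*} [Fintype ι]

/-- The weighted `2m`-th moment `∑ i, μ i ⟪u i, c⟫^(2m)`. -/
noncomputable def evenMoment (μ : ι → ℝ) (u : ι → E) (m : ℕ) (c : E) : ℝ :=
  ∑ i, μ i * ⟪u i, c⟫ ^ (2 * m)

/-- The weighted `p`-th absolute moment `∑ i, μ i |⟪u i, c⟫|^p`. -/
noncomputable def absMoment (μ : ι → ℝ) (u : ι → E) (p : ℝ) (c : E) : ℝ :=
  ∑ i, μ i * |⟪u i, c⟫| ^ p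

lemma evenMoment_nonneg {μ : ι → ℝ} (hμ : ∀ i, 0 ≤ μ i) (u : ι → E) (m : ℕ) (c : E) :
    0 ≤ evenMoment μ u m c :=
  Finset.sum_nonneg fun i _ => mul_nonneg (hμ i) ((even_two_mul m).pow_nonneg _)

lemma absMoment_nonneg {μ : ι → ℝ} (hμ : ∀ i, 0 ≤ μ i) (u : ι → E) (p : ℝ) (c : E) :
    0 ≤ absMoment μ u p c :=
  Finset.sum_nonneg fun i _ => mul_nonneg (hμ i) (Real.rpow_nonneg (abs_nonneg _) p)

lemma evenMoment_sub_comm (μ : ι → ℝ) (u : ι → E) (m : ℕ) (x y : E) :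
    evenMoment μ u m (x - y) = evenMoment μ u m (y - x) := by
  simp only [evenMoment]
  refine Finset.sum_congr rfl fun i _ => ?_
  rw [← neg_sub y x, inner_neg_right, (even_two_mul m).neg_pow]

lemma evenMoment_smul (μ : ι → ℝ) (u : ι → E) (m : ℕ) (r : ℝ) (c : E) :
    evenMoment μ u m (r • c) = r ^ (2 * m) * evenMoment μ u m c := by
  simp only [evenMoment, real_inner_smul_right, mul_pow, Finset.mul_sum]
  exact Finset.sum_congr rfl fun i _ => by ring

lemma evenMoment_sub_le {μ : ι → ℝ} (hμ : ∀ i, 0 ≤ μ i) (u : ι → E) (m : ℕ)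
    (c d : E) : evenMoment μ u m (c - d)
      ≤ 2 ^ (2 * m - 1) * (evenMoment μ u m c + evenMoment μ u m d) := by
  simp only [evenMoment, ← Finset.sum_add_distrib, Finset.mul_sum]
  refine Finset.sum_le_sum fun i _ => ?_
  have h := add_pow_le (abs_nonneg ⟪u i, c⟫) (abs_nonneg ⟪u i, d⟫) (2 * m)
  rw [(even_two_mul m).pow_abs, (even_two_mul m).pow_abs] at h
  have h2 : ⟪u i, c - d⟫ ^ (2 * m) ≤ (|⟪u i, c⟫| + |⟪u i, d⟫|) ^ (2 * m) := by
    rw [← (even_two_mul m).pow_abs ⟪u i, c - d⟫, inner_sub_right]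
    exact pow_le_pow_left₀ (abs_nonneg _) (abs_sub _ _) _
  have := mul_le_mul_of_nonneg_left (h2.trans h) (hμ i)
  linarith

lemma continuous_evenMoment (μ : ι → ℝ) (u : ι → E) (m : ℕ) :
    Continuous (evenMoment μ u m) := by
  unfold evenMoment
  fun_prop

variable [FiniteDimensional ℝ E] [MeasurableSpace E] [BorelSpace E]

lemma half_integral_gaussWeight_le_setIntegral {μ : ι → ℝ} (hμ : ∀ i, 0 ≤ μ i)
    (hμ1 : ∑ i, μ i ≤ 1) {u : ι → E} {n : ℝ} (hn : 0 < n) (hu : ∀ i, ‖u i‖ ^ 2 ≤ n)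
    {m : ℕ} (hm : 0 < m) :
    (∫ x : E, gaussWeight x) / 2
      ≤ ∫ x in {x | evenMoment μ u m x ≤ (24 * m * n) ^ m}, gaussWeight x := by
  set G := ∫ x : E, gaussWeight x
  have hG : 0 < G := integral_gaussWeight_pos
  set K : Set E := {x | evenMoment μ u m x ≤ (24 * m * n) ^ m} with hKdef
  have hK : MeasurableSet K := measurableSet_le (continuous_evenMoment μ u m).measurable
    measurable_const
  have hint : Integrable fun x : E => evenMoment μ u m x * gaussWeight x := by
    unfold evenMoment
    simp_rw [Finset.sum_mul, mul_assoc]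
    exact integrable_finsetSum _ fun i _ => (integrable_inner_pow_mul_gaussWeight _ _).const_mul _
  have htot : ∫ x : E, evenMoment μ u m x * gaussWeight x ≤ 2 * (6 * m * n) ^ m * G := by
    unfold evenMoment
    simp_rw [Finset.sum_mul, mul_assoc (μ _)]
    rw [integral_finsetSum _
      fun i _ => (integrable_inner_pow_mul_gaussWeight _ _).const_mul _]
    simp_rw [integral_const_mul]
    have hb : 0 ≤ 2 * (6 * m * n) ^ m * G := by positivity
    calc ∑ i, μ i * ∫ x : E, ⟪u i, x⟫ ^ (2 * m) * gaussWeight x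
        ≤ ∑ i, μ i * (2 * (6 * m * n) ^ m * G) := Finset.sum_le_sum fun i _ =>
          mul_le_mul_of_nonneg_left (integral_inner_pow_mul_gaussWeight_le hm hn (hu i)) (hμ i)
      _ ≤ 1 * (2 * (6 * m * n) ^ m * G) := by rw [← Finset.sum_mul]; gcongr
      _ = _ := one_mul _
  have hmarkov : (24 * m * n) ^ m * ∫ x in Kᶜ, gaussWeight x ≤ 2 * (6 * m * n) ^ m * G := by
    refine le_trans ?_ htot
    refine le_trans ?_ (setIntegral_le_integral (s := Kᶜ) hint
      (Filter.Eventually.of_forall fun x => mul_nonneg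
        (Finset.sum_nonneg fun i _ => mul_nonneg (hμ i) ((even_two_mul m).pow_nonneg _))
        (gaussWeight_pos x).le))
    rw [← integral_const_mul]
    refine setIntegral_mono_on (integrable_gaussWeight.const_mul _).integrableOn
      hint.integrableOn hK.compl fun x hx => ?_
    have : (24 * m * n) ^ m ≤ evenMoment μ u m x :=
      (lt_of_not_ge (show ¬ evenMoment μ u m x ≤ (24 * m * n) ^ m from hx)).le
    exact mul_le_mul_of_nonneg_right this (gaussWeight_pos x).le
  have hsplit := integral_add_compl hK (integrable_gaussWeight (E := E))
  have hpow : (24 * m * n : ℝ) ^ m = 4 ^ m * (6 * m * n) ^ m := by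
    rw [← mul_pow]; congr 1; ring
  have h4 : (4 : ℝ) ≤ 4 ^ m := le_self_pow₀ (by norm_num) hm.ne'
  have hP : 0 < (6 * m * n : ℝ) ^ m := by
    have : (0 : ℝ) < m := by exact_mod_cast hm
    positivity
  have hc : 0 ≤ ∫ x in Kᶜ, gaussWeight x :=
    setIntegral_nonneg hK.compl fun x _ => (gaussWeight_pos x).le
  have h5 : (6 * m * n : ℝ) ^ m * (4 * ∫ x in Kᶜ, gaussWeight x) ≤ (6 * m * n) ^ m * (2 * G) := by
    rw [hpow] at hmarkov
    have : (6 * m * n : ℝ) ^ m * (4 * ∫ x in Kᶜ, gaussWeight x)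
        ≤ (6 * m * n : ℝ) ^ m * (4 ^ m * ∫ x in Kᶜ, gaussWeight x) := by gcongr
    linarith
  have h6 := le_of_mul_le_mul_left h5 hP
  linarith

/-- Dual Sudakov-type bound on the size of a subset of a Euclidean ball that is separated in
`L_{2m}`. -/
lemma card_le_of_evenMoment_separated {μ : ι → ℝ} (hμ : ∀ i, 0 ≤ μ i)
    (hμ1 : ∑ i, μ i ≤ 1) {u : ι → E} {n : ℝ} (hn : 0 < n) (hu : ∀ i, ‖u i‖ ^ 2 ≤ n)
    {m : ℕ} (hm : 0 < m) {S : Finset E} {y : E} {R s : ℝ} (hs : 0 < s)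
    (hS : ∀ x ∈ S, ‖x - y‖ ^ 2 ≤ R)
    (hsep : ∀ x ∈ S, ∀ x' ∈ S, x ≠ x' → s ^ (2 * m) < evenMoment μ u m (x - x')) :
    (S.card : ℝ) ≤ 2 * Real.exp (48 * m * n * R / s ^ 2) := by
  classical
  have hm' : (0 : ℝ) < m := by exact_mod_cast hm
  set ρ : ℝ := Real.sqrt (24 * m * n) with hρ
  have hρ2 : ρ ^ 2 = 24 * m * n := Real.sq_sqrt (by positivity)
  have hρpos : 0 < ρ := Real.sqrt_pos.2 (by positivity)
  set l : ℝ := 2 * ρ / s with hl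
  have hlpos : 0 < l := by positivity
  set K : Set E := {x | evenMoment μ u m x ≤ (24 * m * n) ^ m} with hKdef
  have hK : MeasurableSet K := measurableSet_le (continuous_evenMoment μ u m).measurable
    measurable_const
  have hinj : Function.Injective fun x : E => l • (x - y) := fun a b h => by
    simpa using smul_right_injective E hlpos.ne' h
  have hcard := card_le_of_disjoint_translates (S := S.image fun x => l • (x - y))
    (R := l ^ 2 * R) hK (fun x => by simp [hKdef, evenMoment, (even_two_mul m).neg_pow])
    (half_integral_gaussWeight_le_setIntegral hμ hμ1 hn hu hm) ?_ ?_
  · rw [Finset.card_image_of_injective _ hinj] at hcard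
    convert hcard using 3
    rw [hl, div_pow, mul_pow, hρ2]
    ring
  · intro a ha
    obtain ⟨x, hx, rfl⟩ := Finset.mem_image.1 ha
    rw [norm_smul, mul_pow, Real.norm_eq_abs, sq_abs]
    exact mul_le_mul_of_nonneg_left (hS x hx) (sq_nonneg _)
  · intro a ha b hb hab z hza hzb
    obtain ⟨x, hx, rfl⟩ := Finset.mem_image.1 ha
    obtain ⟨x', hx', rfl⟩ := Finset.mem_image.1 hb
    have hne : x ≠ x' := fun h => hab (by rw [h])
    have h1 := evenMoment_sub_le hμ u m (z - l • (x' - y)) (z - l • (x - y))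
    have h2 : z - l • (x' - y) - (z - l • (x - y)) = l • (x - x') := by
      simp only [smul_sub]; abel
    rw [h2, evenMoment_smul] at h1
    have h3 := mul_lt_mul_of_pos_left (hsep x hx x' hx' hne) (pow_pos hlpos (2 * m))
    have h4 : l ^ (2 * m) * s ^ (2 * m) = 2 ^ (2 * m) * (24 * m * n) ^ m := by
      rw [← mul_pow, hl, div_mul_cancel₀ _ hs.ne', mul_pow, pow_mul ρ, hρ2]
    have h5 : (2 : ℝ) ^ (2 * m) = 2 ^ (2 * m - 1) * 2 := by
      rw [← pow_succ]; congr 1; omega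
    have h6 : (2 : ℝ) ^ (2 * m - 1) * (evenMoment μ u m (z - l • (x' - y)) +
        evenMoment μ u m (z - l • (x - y)))
        ≤ 2 ^ (2 * m - 1) * ((24 * m * n) ^ m + (24 * m * n) ^ m) := by
      have ha' : evenMoment μ u m (z - l • (x - y)) ≤ (24 * m * n) ^ m := hza
      have hb' : evenMoment μ u m (z - l • (x' - y)) ≤ (24 * m * n) ^ m := hzb
      gcongr
    rw [h4, h5] at h3
    linarith

end Moments

section Estimates

lemma rpow_sub_rpow_sq_le {p a b : ℝ} (hp1 : 1 < p) (hp2 : p < 2) (hb : 0 ≤ b) (hab : b ≤ a) :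
    (a ^ p - b ^ p) ^ 2 ≤ 4 * ((a - b) ^ p * a ^ p) := by
  rcases eq_or_lt_of_le (hb.trans hab) with ha | ha
  · obtain rfl : b = 0 := le_antisymm (by rwa [← ha] at hab) hb
    simp [← ha, Real.zero_rpow (by linarith : p ≠ 0)]
  have hlip : a ^ p - b ^ p ≤ 2 * (a - b) * a ^ (p - 1) := by
    have h := one_add_mul_self_le_rpow_one_add (s := b / a - 1)
      (by linarith [div_nonneg hb ha.le]) hp1.le
    rw [add_sub_cancel, Real.div_rpow hb ha.le, le_div_iff₀ (by positivity)] at h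
    have h2 : a ^ p = a ^ (p - 1) * a := by
      rw [← Real.rpow_add_one ha.ne']; ring_nf
    have h3 : (b / a - 1) * a ^ p = (b - a) * a ^ (p - 1) := by
      rw [h2]; field_simp
    have h4 : 0 ≤ (a - b) * a ^ (p - 1) := mul_nonneg (by linarith) (by positivity)
    nlinarith
  have h0 : 0 ≤ a ^ p - b ^ p := sub_nonneg.2 (Real.rpow_le_rpow hb hab (by linarith))
  have hab' : 0 ≤ a - b := by linarith
  have h1 : (a - b) ^ 2 ≤ (a - b) ^ p * a ^ (2 - p) := by
    rcases eq_or_lt_of_le hab' with h | h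
    · rw [← h]; simp [Real.zero_rpow (by linarith : p ≠ 0)]
    · rw [← Real.rpow_two, show (2 : ℝ) = p + (2 - p) by ring, Real.rpow_add h,
        show p + (2 - p) - p = 2 - p by ring]
      exact mul_le_mul_of_nonneg_left
        (Real.rpow_le_rpow h.le (by linarith) (by linarith)) (by positivity)
  have h2 : a ^ (2 - p) * (a ^ (p - 1)) ^ 2 = a ^ p := by
    rw [← Real.rpow_two (a ^ (p - 1)), ← Real.rpow_mul ha.le, ← Real.rpow_add ha]
    ring_nf
  calc (a ^ p - b ^ p) ^ 2 ≤ (2 * (a - b) * a ^ (p - 1)) ^ 2 := pow_le_pow_left₀ h0 hlip 2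
    _ = 4 * ((a - b) ^ 2 * (a ^ (p - 1)) ^ 2) := by ring
    _ ≤ 4 * ((a - b) ^ p * a ^ (2 - p) * (a ^ (p - 1)) ^ 2) := by gcongr
    _ = _ := by rw [mul_assoc ((a - b) ^ p), h2]

lemma abs_rpow_sub_abs_rpow_sq_le {p : ℝ} (hp1 : 1 < p) (hp2 : p < 2) (x y : ℝ) :
    (|x| ^ p - |y| ^ p) ^ 2 ≤ 4 * (|x - y| ^ p * (|x| ^ p + |y| ^ p)) := by
  wlog h : |y| ≤ |x| generalizing x y
  · have := this y x (le_of_not_ge h)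
    rw [abs_sub_comm, add_comm] at this
    linarith [show (|x| ^ p - |y| ^ p) ^ 2 = (|y| ^ p - |x| ^ p) ^ 2 by ring]
  refine (rpow_sub_rpow_sq_le hp1 hp2 (abs_nonneg y) h).trans ?_
  have h1 : (|x| - |y|) ^ p ≤ |x - y| ^ p :=
    Real.rpow_le_rpow (by linarith) (abs_sub_abs_le_abs_sub x y) (by linarith)
  have h2 : |x| ^ p ≤ |x| ^ p + |y| ^ p := by
    linarith [Real.rpow_nonneg (abs_nonneg y) p]
  gcongr

lemma abs_sub_rpow_le {p : ℝ} (hp1 : 1 < p) (hp2 : p < 2) (x y : ℝ) :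
    |x - y| ^ p ≤ 4 * (|x| ^ p + |y| ^ p) := by
  wlog h : |y| ≤ |x| generalizing x y
  · have := this y x (le_of_not_ge h)
    rw [abs_sub_comm, add_comm] at this
    linarith
  have h0 : |x - y| ≤ 2 * |x| := (abs_sub x y).trans (by linarith)
  have h1 : |x - y| ^ p ≤ 2 ^ p * |x| ^ p := by
    rw [← Real.mul_rpow (by norm_num) (abs_nonneg x)]
    exact Real.rpow_le_rpow (abs_nonneg _) h0 (by linarith)
  have h2 : (2 : ℝ) ^ p ≤ 4 := by
    calc (2 : ℝ) ^ p ≤ 2 ^ (2 : ℝ) := Real.rpow_le_rpow_of_exponent_le (by norm_num) hp2.le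
      _ = 4 := by norm_num
  have h3 := Real.rpow_nonneg (abs_nonneg x) p
  have h4 := Real.rpow_nonneg (abs_nonneg y) p
  nlinarith

lemma sq_le_rpow_add_pow {p : ℝ} (hp2 : p < 2) {m : ℕ} (hm : 0 < m) {b : ℝ} (hb : 0 ≤ b) :
    b ^ 2 ≤ b ^ p + b ^ (2 * m) := by
  rcases le_or_gt b 1 with h | h
  · rcases eq_or_lt_of_le hb with h0 | h0
    · rw [← h0]
      have := Real.rpow_nonneg (le_refl (0 : ℝ)) p
      simp only [ne_eq, OfNat.ofNat_ne_zero, not_false_eq_true, zero_pow]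
      positivity
    · have := Real.rpow_le_rpow_of_exponent_ge h0 h hp2.le
      rw [Real.rpow_two] at this
      linarith [pow_nonneg hb (2 * m)]
  · have := pow_le_pow_right₀ h.le (show 2 ≤ 2 * m by omega)
    linarith [Real.rpow_nonneg hb p]

lemma rpow_le_one_add_pow {p : ℝ} (hp0 : 0 < p) (hp2 : p < 2) {m : ℕ} (hm : 0 < m) {b : ℝ}
    (hb : 0 ≤ b) : b ^ p ≤ 1 + b ^ (2 * m) := by
  rcases le_or_gt b 1 with h | h
  · linarith [Real.rpow_le_one hb h hp0.le, pow_nonneg hb (2 * m)]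
  · have h1 := Real.rpow_le_rpow_of_exponent_le h.le hp2.le
    rw [Real.rpow_two] at h1
    have := pow_le_pow_right₀ h.le (show 2 ≤ 2 * m by omega)
    linarith

variable {E : Type*} [NormedAddCommGroup E] [InnerProductSpace ℝ E]
  {ι : Type*} [Fintype ι]

lemma abs_inner_rpow_le {p : ℝ} (hp1 : 1 < p) (hp2 : p < 2) {μ : ι → ℝ} (hμ : ∀ i, 0 ≤ μ i)
    {u : ι → E} {n : ℝ} (hn : 0 < n) (hu : ∀ i, ‖u i‖ ^ 2 ≤ n)
    (hframe : ∀ c, ‖c‖ ^ 2 ≤ ∑ i, μ i * ⟪u i, c⟫ ^ 2) {c : E} (hc : absMoment μ u p c ≤ 1)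
    (i : ι) : |⟪u i, c⟫| ^ p ≤ n := by
  have hs0 : 0 < Real.sqrt n := Real.sqrt_pos.2 hn
  have hle : ∀ i, |⟪u i, c⟫| ≤ Real.sqrt n * ‖c‖ := fun i =>
    (abs_real_inner_le_norm _ _).trans
      (mul_le_mul_of_nonneg_right (Real.le_sqrt_of_sq_le (hu i)) (norm_nonneg _))
  rcases eq_or_lt_of_le (norm_nonneg c) with h0 | h0
  · rw [norm_eq_zero.1 h0.symm]
    simp [Real.zero_rpow (by linarith : p ≠ 0), hn.le]
  have h1 : ‖c‖ ^ 2 ≤ (Real.sqrt n * ‖c‖) ^ (2 - p) := by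
    calc ‖c‖ ^ 2 ≤ ∑ i, μ i * ⟪u i, c⟫ ^ 2 := hframe c
      _ ≤ ∑ i, μ i * |⟪u i, c⟫| ^ p * (Real.sqrt n * ‖c‖) ^ (2 - p) := by
          refine Finset.sum_le_sum fun i _ => ?_
          rw [mul_assoc]
          refine mul_le_mul_of_nonneg_left ?_ (hμ i)
          rcases eq_or_lt_of_le (abs_nonneg ⟪u i, c⟫) with h | h
          · rw [← sq_abs, ← h]
            simp [Real.zero_rpow (by linarith : p ≠ 0)]
          · rw [← sq_abs, ← Real.rpow_two, show (2 : ℝ) = p + (2 - p) by ring, Real.rpow_add h,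
              show p + (2 - p) - p = 2 - p by ring]
            exact mul_le_mul_of_nonneg_left
              (Real.rpow_le_rpow h.le (hle i) (by linarith)) (by positivity)
      _ = absMoment μ u p c * (Real.sqrt n * ‖c‖) ^ (2 - p) := by
          rw [absMoment, Finset.sum_mul]
      _ ≤ 1 * (Real.sqrt n * ‖c‖) ^ (2 - p) := by gcongr
      _ = _ := one_mul _
  have hpos : 0 < Real.sqrt n * ‖c‖ := by positivity
  have h2 : (Real.sqrt n * ‖c‖) ^ p * (Real.sqrt n * ‖c‖) ^ (2 - p) = n * ‖c‖ ^ 2 := by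
    rw [← Real.rpow_add hpos, show p + (2 - p) = 2 by ring, Real.rpow_two, mul_pow,
      Real.sq_sqrt hn.le]
  have h3 : (Real.sqrt n * ‖c‖) ^ p ≤ n := by
    refine le_of_mul_le_mul_right ?_ (Real.rpow_pos_of_pos hpos (2 - p))
    rw [h2]
    exact mul_le_mul_of_nonneg_left h1 hn.le
  exact (Real.rpow_le_rpow (abs_nonneg _) (hle i) (by linarith)).trans h3

lemma sum_scaled_pow {μ : ι → ℝ} (u : ι → E) (m : ℕ) (θ : ℝ) (z : E) :
    ∑ i, μ i * (|⟪u i, z⟫| / θ) ^ (2 * m) = evenMoment μ u m z / θ ^ (2 * m) := by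
  rw [evenMoment, Finset.sum_div]
  refine Finset.sum_congr rfl fun i _ => ?_
  rw [div_pow, (even_two_mul m).pow_abs, mul_div_assoc]

lemma sum_scaled_rpow {μ : ι → ℝ} (u : ι → E) (p : ℝ) {θ : ℝ} (hθ : 0 < θ) (z : E) :
    ∑ i, μ i * (|⟪u i, z⟫| / θ) ^ p = absMoment μ u p z / θ ^ p := by
  rw [absMoment, Finset.sum_div]
  refine Finset.sum_congr rfl fun i _ => ?_
  rw [Real.div_rpow (abs_nonneg _) hθ.le, mul_div_assoc]

lemma sum_sq_eq {μ : ι → ℝ} (u : ι → E) {θ : ℝ} (hθ : 0 < θ) (z : E) :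
    ∑ i, μ i * ⟪u i, z⟫ ^ 2 = θ ^ 2 * ∑ i, μ i * (|⟪u i, z⟫| / θ) ^ 2 := by
  rw [Finset.mul_sum]
  refine Finset.sum_congr rfl fun i _ => ?_
  rw [div_pow, sq_abs]
  field_simp

lemma absMoment_sub_le {p : ℝ} (hp1 : 1 < p) (hp2 : p < 2) {μ : ι → ℝ} (hμ : ∀ i, 0 ≤ μ i)
    (u : ι → E) (x y : E) :
    absMoment μ u p (x - y) ≤ 4 * (absMoment μ u p x + absMoment μ u p y) := by
  simp only [absMoment, ← Finset.sum_add_distrib, Finset.mul_sum]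
  refine Finset.sum_le_sum fun i _ => ?_
  have := mul_le_mul_of_nonneg_left (abs_sub_rpow_le hp1 hp2 ⟪u i, x⟫ ⟪u i, y⟫) (hμ i)
  rw [inner_sub_right]
  linarith

/-- The Euclidean size of a difference of elements of the `L_p` unit ball which is at most `t`
in `L_{2m}`. -/
lemma norm_sub_sq_le {p : ℝ} (hp1 : 1 < p) (hp2 : p < 2) {μ : ι → ℝ} (hμ : ∀ i, 0 ≤ μ i)
    (hμ1 : ∑ i, μ i ≤ 1) {u : ι → E} {n : ℝ} (hn : 1 ≤ n)
    (hframe : ∀ c, ‖c‖ ^ 2 ≤ ∑ i, μ i * ⟪u i, c⟫ ^ 2) {m : ℕ} (hm : Real.log n + 1 ≤ m)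
    {t : ℝ} (ht : 0 < t) (htn : t ^ p ≤ 4 * n)
    {x y : E} (hx : absMoment μ u p x ≤ 1) (hy : absMoment μ u p y ≤ 1)
    (hxy : evenMoment μ u m (x - y) ≤ t ^ (2 * m)) :
    ‖x - y‖ ^ 2 ≤ 28 * t ^ 2 * min (t ^ (-p)) 1 := by
  have hlog := Real.log_nonneg hn
  have hm0 : 0 < m := by exact_mod_cast (by linarith : (0 : ℝ) < m)
  have htp : 0 < t ^ p := Real.rpow_pos_of_pos ht p
  rw [mul_min_of_nonneg _ _ (by positivity), mul_one]
  refine le_min ?_ ?_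
  · set θ : ℝ := Real.exp 1 * t with hθ
    have hθpos : 0 < θ := by positivity
    refine (hframe _).trans ?_
    rw [sum_sq_eq u hθpos]
    have h1 : ∑ i, μ i * (|⟪u i, x - y⟫| / θ) ^ 2 ≤ 8 / θ ^ p + t ^ (2 * m) / θ ^ (2 * m) := by
      calc ∑ i, μ i * (|⟪u i, x - y⟫| / θ) ^ 2
          ≤ ∑ i, μ i * ((|⟪u i, x - y⟫| / θ) ^ p + (|⟪u i, x - y⟫| / θ) ^ (2 * m)) :=
            Finset.sum_le_sum fun i _ => mul_le_mul_of_nonneg_left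
              (sq_le_rpow_add_pow hp2 hm0 (by positivity)) (hμ i)
        _ = absMoment μ u p (x - y) / θ ^ p + evenMoment μ u m (x - y) / θ ^ (2 * m) := by
            simp_rw [mul_add]
            rw [Finset.sum_add_distrib, sum_scaled_pow, sum_scaled_rpow u p hθpos]
        _ ≤ _ := by
            have := absMoment_sub_le hp1 hp2 hμ u x y
            gcongr
            linarith
    have hθp : θ ^ p = Real.exp p * t ^ p := by
      rw [hθ, Real.mul_rpow (Real.exp_pos _).le ht.le, ← Real.exp_mul, one_mul]
    have hq : t ^ (2 * m) / θ ^ (2 * m) = Real.exp (-(2 * m)) := by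
      rw [hθ, mul_pow, ← Real.exp_nat_mul, Real.exp_neg]
      push_cast
      field_simp
    have he : Real.exp (2 - 2 * m) ≤ 4 / t ^ p := by
      calc Real.exp (2 - 2 * m) ≤ Real.exp (-(2 * Real.log n)) :=
            Real.exp_le_exp.2 (by linarith)
        _ = 1 / n ^ 2 := by
            rw [Real.exp_neg, two_mul, Real.exp_add, Real.exp_log (by linarith)]; ring
        _ ≤ 1 / n := one_div_le_one_div_of_le (by linarith) (by nlinarith)
        _ ≤ 4 / t ^ p := by
            rw [div_le_div_iff₀ (by linarith) htp]; linarith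
    have he1 : Real.exp (2 - p) ≤ 3 := by
      calc Real.exp (2 - p) ≤ Real.exp 1 := Real.exp_le_exp.2 (by linarith)
        _ ≤ 3 := by linarith [Real.exp_one_lt_d9]
    have h2 : θ ^ 2 * (8 / θ ^ p + t ^ (2 * m) / θ ^ (2 * m))
        = t ^ 2 * (8 * Real.exp (2 - p) / t ^ p + Real.exp (2 - 2 * m)) := by
      have e1 : Real.exp (2 - p) = Real.exp 1 ^ 2 / Real.exp p := by
        rw [Real.exp_sub, ← Real.exp_nat_mul]; norm_num
      have e2 : Real.exp (2 - 2 * m) = Real.exp 1 ^ 2 * Real.exp (-(2 * m)) := by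
        rw [← Real.exp_nat_mul, ← Real.exp_add]; push_cast; ring_nf
      rw [hθp, hq, e1, e2, hθ]
      field_simp
    calc θ ^ 2 * ∑ i, μ i * (|⟪u i, x - y⟫| / θ) ^ 2
        ≤ θ ^ 2 * (8 / θ ^ p + t ^ (2 * m) / θ ^ (2 * m)) := by gcongr
      _ = t ^ 2 * (8 * Real.exp (2 - p) / t ^ p + Real.exp (2 - 2 * m)) := h2
      _ ≤ t ^ 2 * (8 * 3 / t ^ p + 4 / t ^ p) := by gcongr
      _ = 28 * t ^ 2 * t ^ (-p) := by rw [Real.rpow_neg ht.le]; ring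
  · refine (hframe _).trans ?_
    rw [sum_sq_eq u ht]
    have h1 : ∑ i, μ i * (|⟪u i, x - y⟫| / t) ^ 2 ≤ 2 := by
      calc ∑ i, μ i * (|⟪u i, x - y⟫| / t) ^ 2
          ≤ ∑ i, μ i * (1 + (|⟪u i, x - y⟫| / t) ^ (2 * m)) := by
            refine Finset.sum_le_sum fun i _ => mul_le_mul_of_nonneg_left ?_ (hμ i)
            rw [pow_mul]
            set w := (|⟪u i, x - y⟫| / t) ^ 2
            rcases le_or_gt w 1 with h | h
            · have : 0 ≤ w ^ m := by positivity
              linarith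
            · linarith [le_self_pow₀ h.le hm0.ne']
        _ = ∑ i, μ i + evenMoment μ u m (x - y) / t ^ (2 * m) := by
            simp_rw [mul_add, mul_one]
            rw [Finset.sum_add_distrib, sum_scaled_pow]
        _ ≤ 1 + 1 := by
            have := div_le_one_of_le₀ hxy (by positivity)
            linarith
        _ = 2 := by norm_num
    nlinarith [sq_nonneg t]

/-- The `L₂` distance of `|x|^p` and `|y|^p` when `x`, `y` are in the `L_p` unit ball and are at
most `t` apart in `L_{2m}`. -/
lemma sum_rpow_sub_rpow_sq_le {p : ℝ} (hp1 : 1 < p) (hp2 : p < 2) {μ : ι → ℝ}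
    (hμ : ∀ i, 0 ≤ μ i) {u : ι → E} {n : ℝ} (hn : 1 ≤ n) (hu : ∀ i, ‖u i‖ ^ 2 ≤ n)
    (hframe : ∀ c, ‖c‖ ^ 2 ≤ ∑ i, μ i * ⟪u i, c⟫ ^ 2) {m : ℕ} (hm : Real.log n + 1 ≤ m)
    {t : ℝ} (ht : 0 < t)
    {x y : E} (hx : absMoment μ u p x ≤ 1) (hy : absMoment μ u p y ≤ 1)
    (hxy : evenMoment μ u m (x - y) ≤ t ^ (2 * m)) :
    ∑ i, μ i * (|⟪u i, x⟫| ^ p - |⟪u i, y⟫| ^ p) ^ 2 ≤ 144 * t ^ p := by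
  have hlog := Real.log_nonneg hn
  have hm0 : 0 < m := by exact_mod_cast (by linarith : (0 : ℝ) < m)
  have htp : 0 < t ^ p := Real.rpow_pos_of_pos ht p
  set θ : ℝ := Real.exp 1 * t with hθ
  have hθpos : 0 < θ := by positivity
  have hθp : θ ^ p ≤ 9 * t ^ p := by
    rw [hθ, Real.mul_rpow (Real.exp_pos _).le ht.le, ← Real.exp_mul, one_mul]
    gcongr
    calc Real.exp p ≤ Real.exp 1 ^ 2 := by
          rw [← Real.exp_nat_mul]; exact Real.exp_le_exp.2 (by push_cast; linarith)
      _ ≤ 3 ^ 2 := by gcongr; linarith [Real.exp_one_lt_d9]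
      _ = 9 := by norm_num
  have hpt : ∀ i, μ i * (|⟪u i, x⟫| ^ p - |⟪u i, y⟫| ^ p) ^ 2 ≤
      4 * θ ^ p * (μ i * |⟪u i, x⟫| ^ p + μ i * |⟪u i, y⟫| ^ p +
        2 * n * (μ i * (|⟪u i, x - y⟫| / θ) ^ (2 * m))) := by
    intro i
    have h1 := abs_rpow_sub_abs_rpow_sq_le hp1 hp2 ⟪u i, x⟫ ⟪u i, y⟫
    have hbx := abs_inner_rpow_le hp1 hp2 hμ (by linarith) hu hframe hx i
    have hby := abs_inner_rpow_le hp1 hp2 hμ (by linarith) hu hframe hy i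
    have h2 : |⟪u i, x - y⟫| ^ p ≤ θ ^ p * (1 + (|⟪u i, x - y⟫| / θ) ^ (2 * m)) := by
      have := rpow_le_one_add_pow (p := p) (by linarith) hp2 hm0
        (b := |⟪u i, x - y⟫| / θ) (by positivity)
      rw [Real.div_rpow (abs_nonneg _) hθpos.le, div_le_iff₀ (by positivity)] at this
      linarith
    rw [← inner_sub_right] at h1
    set s := |⟪u i, x⟫| ^ p + |⟪u i, y⟫| ^ p with hs
    set w := (|⟪u i, x - y⟫| / θ) ^ (2 * m)
    have hs0 : 0 ≤ s := by positivity
    have hw0 : 0 ≤ w := by positivity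
    have h3 : |⟪u i, x - y⟫| ^ p * s ≤ θ ^ p * (s + 2 * n * w) := by
      calc |⟪u i, x - y⟫| ^ p * s ≤ θ ^ p * (1 + w) * s := by gcongr
        _ = θ ^ p * (s + s * w) := by ring
        _ ≤ θ ^ p * (s + 2 * n * w) := by
            gcongr
            linarith
    calc μ i * (|⟪u i, x⟫| ^ p - |⟪u i, y⟫| ^ p) ^ 2
        ≤ μ i * (4 * (θ ^ p * (s + 2 * n * w))) :=
          mul_le_mul_of_nonneg_left (h1.trans (by linarith)) (hμ i)
      _ = _ := by rw [hs]; ring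
  have hexp : 2 * n * (evenMoment μ u m (x - y) / θ ^ (2 * m)) ≤ 2 := by
    have h1 : evenMoment μ u m (x - y) / θ ^ (2 * m) ≤ t ^ (2 * m) / θ ^ (2 * m) := by gcongr
    have hq : t ^ (2 * m) / θ ^ (2 * m) = Real.exp (-(2 * m)) := by
      rw [hθ, mul_pow, ← Real.exp_nat_mul, Real.exp_neg]
      push_cast
      field_simp
    have h2 : Real.exp (-(2 * m)) ≤ 1 / n := by
      calc Real.exp (-(2 * m)) ≤ Real.exp (-Real.log n) := Real.exp_le_exp.2 (by linarith)
        _ = 1 / n := by rw [Real.exp_neg, Real.exp_log (by linarith), one_div]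
    calc 2 * n * (evenMoment μ u m (x - y) / θ ^ (2 * m)) ≤ 2 * n * (1 / n) :=
          mul_le_mul_of_nonneg_left ((h1.trans_eq hq).trans h2) (by linarith)
      _ = 2 := by field_simp
  calc ∑ i, μ i * (|⟪u i, x⟫| ^ p - |⟪u i, y⟫| ^ p) ^ 2
      ≤ ∑ i, 4 * θ ^ p * (μ i * |⟪u i, x⟫| ^ p + μ i * |⟪u i, y⟫| ^ p +
        2 * n * (μ i * (|⟪u i, x - y⟫| / θ) ^ (2 * m))) := Finset.sum_le_sum fun i _ => hpt i
    _ = 4 * θ ^ p * (absMoment μ u p x + absMoment μ u p y +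
        2 * n * (evenMoment μ u m (x - y) / θ ^ (2 * m))) := by
        rw [← Finset.mul_sum, Finset.sum_add_distrib, Finset.sum_add_distrib, ← Finset.mul_sum,
          sum_scaled_pow]
        rfl
    _ ≤ 4 * (9 * t ^ p) * (1 + 1 + 2) := by
        have h1 : 0 ≤ absMoment μ u p x := absMoment_nonneg hμ u p x
        have h2 : 0 ≤ absMoment μ u p y := absMoment_nonneg hμ u p y
        have h3 : 0 ≤ evenMoment μ u m (x - y) := evenMoment_nonneg hμ u m (x - y)
        gcongr
    _ = 144 * t ^ p := by ring

end Estimates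

section Nets

variable {E : Type*} [NormedAddCommGroup E] [InnerProductSpace ℝ E] [FiniteDimensional ℝ E]
  [MeasurableSpace E] [BorelSpace E] {ι : Type*} [Fintype ι]

/-- The bound for the logarithm of the number of `t/2`-separated points of the `L_p` unit ball in
an `L_{2m}` ball of radius `t`. -/
noncomputable def localEntropy (p n t : ℝ) : ℝ :=
  21508 * (n * Real.log n) * min (t ^ (-p)) 1

lemma one_le_mul_min {p n t : ℝ} (hn : 1 ≤ n) (ht : 0 < t) (htn : t ^ p ≤ 4 * n) :
    1 ≤ 4 * n * min (t ^ (-p)) 1 := by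
  have htp : 0 < t ^ p := Real.rpow_pos_of_pos ht p
  rw [mul_min_of_nonneg _ _ (by linarith), mul_one, Real.rpow_neg ht.le, ← div_eq_mul_inv]
  exact le_min ((one_le_div htp).2 htn) (by linarith)

lemma card_le_of_local_separated {p : ℝ} (hp1 : 1 < p) (hp2 : p < 2) {μ : ι → ℝ}
    (hμ : ∀ i, 0 ≤ μ i) (hμ1 : ∑ i, μ i ≤ 1) {u : ι → E} {n : ℝ} (hn : 2 ≤ n)
    (hu : ∀ i, ‖u i‖ ^ 2 ≤ n)
    (hframe : ∀ c, ‖c‖ ^ 2 ≤ ∑ i, μ i * ⟪u i, c⟫ ^ 2) {m : ℕ} (hm : Real.log n + 1 ≤ m)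
    (hm' : (m : ℝ) ≤ 4 * Real.log n) {t : ℝ} (ht : 0 < t) (htn : t ^ p ≤ 4 * n)
    {S : Finset E} {y : E} (hy : absMoment μ u p y ≤ 1) (hS : ∀ x ∈ S, absMoment μ u p x ≤ 1)
    (hSy : ∀ x ∈ S, evenMoment μ u m (x - y) ≤ t ^ (2 * m))
    (hsep : ∀ x ∈ S, ∀ x' ∈ S, x ≠ x' → (t / 2) ^ (2 * m) < evenMoment μ u m (x - x')) :
    (S.card : ℝ) ≤ Real.exp (localEntropy p n t) := by
  have hlog : 0 ≤ Real.log n := Real.log_nonneg (by linarith)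
  have hm0 : 0 < m := by exact_mod_cast (by linarith : (0 : ℝ) < m)
  have hmin := one_le_mul_min (by linarith) ht htn
  have hlog2 : Real.log 2 ≤ Real.log n := Real.log_le_log (by norm_num) hn
  set w := min (t ^ (-p)) 1
  have hw : 0 < w := by by_contra! h; nlinarith
  refine (card_le_of_evenMoment_separated hμ hμ1 (by linarith) hu hm0 (half_pos ht)
    (fun x hx => norm_sub_sq_le hp1 hp2 hμ hμ1 (by linarith) hframe hm ht htn (hS x hx) hy
      (hSy x hx)) hsep).trans ?_
  rw [show (2 : ℝ) * Real.exp (48 * m * n * (28 * t ^ 2 * w) / (t / 2) ^ 2)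
    = Real.exp (Real.log 2 + 5376 * (m * (n * w))) by
      rw [Real.exp_add, Real.exp_log (by norm_num)]
      congr 2
      field_simp
      ring]
  refine Real.exp_le_exp.2 ?_
  rw [localEntropy]
  have h1 : (m : ℝ) * (n * w) ≤ 4 * Real.log n * (n * w) := by gcongr
  have h2 : Real.log n * 1 ≤ Real.log n * (4 * n * w) := by gcongr
  calc Real.log 2 + 5376 * (m * (n * w))
      ≤ Real.log n * (4 * n * w) + 5376 * (4 * Real.log n * (n * w)) := by linarith
    _ = 21508 * (n * Real.log n) * w := by ring

lemma exists_finer_net {p : ℝ} (hp1 : 1 < p) (hp2 : p < 2) {μ : ι → ℝ}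
    (hμ : ∀ i, 0 ≤ μ i) (hμ1 : ∑ i, μ i ≤ 1) {u : ι → E} {n : ℝ} (hn : 2 ≤ n)
    (hu : ∀ i, ‖u i‖ ^ 2 ≤ n)
    (hframe : ∀ c, ‖c‖ ^ 2 ≤ ∑ i, μ i * ⟪u i, c⟫ ^ 2) {m : ℕ} (hm : Real.log n + 1 ≤ m)
    (hm' : (m : ℝ) ≤ 4 * Real.log n) {t : ℝ} (ht : 0 < t) (htn : t ^ p ≤ 4 * n)
    {T : Finset E} (hT : ∀ x ∈ T, absMoment μ u p x ≤ 1)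
    (hnet : ∀ x, absMoment μ u p x ≤ 1 → ∃ y ∈ T, evenMoment μ u m (x - y) ≤ t ^ (2 * m)) :
    ∃ T' : Finset E, (∀ x ∈ T', absMoment μ u p x ≤ 1) ∧
      (T'.card : ℝ) ≤ T.card * Real.exp (localEntropy p n t) ∧
      ∀ x, absMoment μ u p x ≤ 1 →
        ∃ y ∈ T', evenMoment μ u m (x - y) ≤ (t / 2) ^ (2 * m) := by
  classical
  have hm0 : 0 < m := by
    exact_mod_cast (by linarith [Real.log_nonneg (show 1 ≤ n by linarith)] : (0 : ℝ) < m)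
  let P : Finset E → Prop := fun S => (∀ x ∈ S, absMoment μ u p x ≤ 1) ∧
    ∀ x ∈ S, ∀ x' ∈ S, x ≠ x' → (t / 2) ^ (2 * m) < evenMoment μ u m (x - x')
  choose! f hfT hf using hnet
  have hcard : ∀ S, P S → (S.card : ℝ) ≤ T.card * Real.exp (localEntropy p n t) := by
    rintro S ⟨hSB, hsep⟩
    rw [Finset.card_eq_sum_card_fiberwise (f := f) (t := T) fun x hx => hfT x (hSB x hx)]
    push_cast
    rw [← nsmul_eq_mul, ← Finset.sum_const]
    refine Finset.sum_le_sum fun y hy => ?_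
    refine card_le_of_local_separated hp1 hp2 hμ hμ1 hn hu hframe hm hm' ht htn (hT y hy)
      (fun x hx => hSB x (Finset.mem_filter.1 hx).1) (fun x hx => ?_)
      (fun x hx x' hx' => hsep x (Finset.mem_filter.1 hx).1 x' (Finset.mem_filter.1 hx').1)
    obtain ⟨hxS, rfl⟩ := Finset.mem_filter.1 hx
    exact hf x (hSB x hxS)
  obtain ⟨S, hS, hmax⟩ : ∃ S, P S ∧ ∀ S', P S' → S'.card ≤ S.card := by
    let A : Set ℕ := {k | ∃ S, P S ∧ S.card = k}
    have hne : A.Nonempty := ⟨0, ∅, ⟨by simp, by simp⟩, rfl⟩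
    have hbdd : BddAbove A := by
      refine ⟨⌊T.card * Real.exp (localEntropy p n t)⌋₊, ?_⟩
      rintro _ ⟨S, hS, rfl⟩
      exact Nat.le_floor (hcard S hS)
    obtain ⟨S, hS, hcS⟩ := Nat.sSup_mem hne hbdd
    exact ⟨S, hS, fun S' hS' => hcS ▸ le_csSup hbdd ⟨S', hS', rfl⟩⟩
  refine ⟨S, hS.1, hcard S hS, fun x hx => ?_⟩
  by_contra! hfar
  have hxS : x ∉ S := by
    intro h
    have := hfar x h
    rw [sub_self] at this
    have h0 : evenMoment μ u m (0 : E) = 0 := by simp [evenMoment, hm0.ne']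
    have h1 : 0 < (t / 2) ^ (2 * m) := by positivity
    linarith
  have hins : P (insert x S) := by
    refine ⟨?_, ?_⟩
    · intro z hz
      rcases Finset.mem_insert.1 hz with rfl | hz
      exacts [hx, hS.1 z hz]
    · intro z hz z' hz' hne
      rcases Finset.mem_insert.1 hz with rfl | hzS <;> rcases Finset.mem_insert.1 hz' with rfl | hzS'
      · exact absurd rfl hne
      · exact hfar z' hzS'
      · rw [evenMoment_sub_comm]
        exact hfar z hzS
      · exact hS.2 z hzS z' hzS' hne
  have := hmax _ hins
  rw [Finset.card_insert_of_notMem hxS] at this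
  omega

/-- Nets of the `L_p` unit ball for the `L_{2m}` norm at the scales `T / 2 ^ k`. -/
lemma exists_nets {p : ℝ} (hp1 : 1 < p) (hp2 : p < 2) {μ : ι → ℝ}
    (hμ : ∀ i, 0 ≤ μ i) (hμ1 : ∑ i, μ i ≤ 1) {u : ι → E} {n : ℝ} (hn : 2 ≤ n)
    (hu : ∀ i, ‖u i‖ ^ 2 ≤ n)
    (hframe : ∀ c, ‖c‖ ^ 2 ≤ ∑ i, μ i * ⟪u i, c⟫ ^ 2) {m : ℕ} (hm : Real.log n + 1 ≤ m)
    (hm' : (m : ℝ) ≤ 4 * Real.log n) {T : ℝ} (hT : 0 < T) (hnT : n ≤ T ^ p)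
    (hTn : T ^ p ≤ 4 * n) (k : ℕ) :
    ∃ S : Finset E, (k = 0 → S = {0}) ∧ (∀ x ∈ S, absMoment μ u p x ≤ 1) ∧
      (S.card : ℝ) ≤ Real.exp (∑ j ∈ Finset.range k, localEntropy p n (T / 2 ^ j)) ∧
      ∀ x, absMoment μ u p x ≤ 1 →
        ∃ y ∈ S, evenMoment μ u m (x - y) ≤ (T / 2 ^ k) ^ (2 * m) := by
  induction k with
  | zero =>
    refine ⟨{0}, fun _ => rfl, ?_, by simp, fun x hx => ⟨0, by simp, ?_⟩⟩
    · simp [absMoment, Real.zero_rpow (by linarith : p ≠ 0)]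
    · rw [sub_zero, pow_zero, div_one, evenMoment]
      have hi : ∀ i, |⟪u i, x⟫| ≤ T := fun i =>
        (Real.rpow_le_rpow_iff (abs_nonneg _) hT.le (by linarith)).1
          ((abs_inner_rpow_le hp1 hp2 hμ (by linarith) hu hframe hx i).trans hnT)
      calc ∑ i, μ i * ⟪u i, x⟫ ^ (2 * m) ≤ ∑ i, μ i * T ^ (2 * m) := by
            refine Finset.sum_le_sum fun i _ => mul_le_mul_of_nonneg_left ?_ (hμ i)
            rw [← (even_two_mul m).pow_abs]
            exact pow_le_pow_left₀ (abs_nonneg _) (hi i) _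
        _ = (∑ i, μ i) * T ^ (2 * m) := by rw [Finset.sum_mul]
        _ ≤ 1 * T ^ (2 * m) := by gcongr
        _ = _ := one_mul _
  | succ k ih =>
    obtain ⟨S, -, hS, hcard, hnet⟩ := ih
    have htn : (T / 2 ^ k) ^ p ≤ 4 * n :=
      (Real.rpow_le_rpow (by positivity) (div_le_self hT.le (one_le_pow₀ (by norm_num)))
        (by linarith)).trans hTn
    obtain ⟨S', hS', hcard', hnet'⟩ := exists_finer_net hp1 hp2 hμ hμ1 hn hu hframe hm hm'
      (by positivity : 0 < T / 2 ^ k) htn hS hnet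
    refine ⟨S', fun h => absurd h k.succ_ne_zero, hS', hcard'.trans ?_, fun x hx => ?_⟩
    · rw [Finset.sum_range_succ, Real.exp_add]
      gcongr
    · obtain ⟨y, hy, h⟩ := hnet' x hx
      exact ⟨y, hy, by rwa [pow_succ, ← div_div]⟩

end Nets

section Signs

variable {ι κ : Type*} [Fintype ι]

/-- The sign `1` or `-1` attached to a Boolean. -/
def sign (b : Bool) : ℝ := if b then 1 else -1

lemma sum_exp_signs_le [DecidableEq ι] (a : ι → ℝ) (l : ℝ) :
    ∑ ε : ι → Bool, Real.exp (l * ∑ i, sign (ε i) * a i)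
      ≤ 2 ^ Fintype.card ι * Real.exp (l ^ 2 * (∑ i, a i ^ 2) / 2) := by
  calc ∑ ε : ι → Bool, Real.exp (l * ∑ i, sign (ε i) * a i)
      = ∑ ε : ι → Bool, ∏ i, Real.exp (l * (sign (ε i) * a i)) := by
        simp_rw [Finset.mul_sum, Real.exp_sum]
    _ = ∏ i, ∑ b : Bool, Real.exp (l * (sign b * a i)) := by
        rw [Finset.prod_univ_sum, Fintype.piFinset_univ]
    _ ≤ ∏ i, (2 * Real.exp ((l * a i) ^ 2 / 2)) := by
        refine Finset.prod_le_prod (fun i _ => Finset.sum_nonneg fun _ _ => (Real.exp_pos _).le)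
          fun i _ => ?_
        have := Real.cosh_le_exp_half_sq (l * a i)
        rw [Real.cosh_eq] at this
        simp only [Fintype.sum_bool, sign, if_true, Bool.false_eq_true, if_false, one_mul, neg_mul,
          mul_neg]
        linarith
    _ = _ := by
        rw [Finset.prod_mul_distrib, ← Real.exp_sum, Finset.prod_const, Finset.card_univ,
          ← Finset.sum_div, Finset.mul_sum]
        simp_rw [mul_pow]

/-- If the Gaussian tails of finitely many vectors sum to less than one, then some choice of signs
makes all the signed sums small. -/
lemma exists_signs (J : Finset κ) (a : κ → ι → ℝ) (D r : κ → ℝ) (hD : ∀ l ∈ J, 0 < D l)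
    (hr : ∀ l ∈ J, 0 < r l) (ha : ∀ l ∈ J, ∑ i, a l i ^ 2 ≤ D l ^ 2)
    (hJ : ∑ l ∈ J, 2 * Real.exp (-(r l ^ 2 / 2)) < 1) :
    ∃ ε : ι → Bool, ∀ l ∈ J, |∑ i, sign (ε i) * a l i| ≤ r l * D l := by
  classical
  let Z : κ → (ι → Bool) → ℝ := fun l ε => ∑ i, sign (ε i) * a l i
  let F : (ι → Bool) → ℝ := fun ε => ∑ l ∈ J, Real.exp (-(r l ^ 2)) *
    (Real.exp (r l / D l * Z l ε) + Real.exp (-(r l / D l) * Z l ε))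
  have hsum : ∑ ε, F ε < ∑ _ε : ι → Bool, (1 : ℝ) := by
    have hF : ∑ ε, F ε ≤ ∑ l ∈ J, 2 ^ Fintype.card ι * (2 * Real.exp (-(r l ^ 2 / 2))) := by
      simp only [F]
      rw [Finset.sum_comm]
      refine Finset.sum_le_sum fun l hl => ?_
      rw [← Finset.mul_sum, Finset.sum_add_distrib]
      have hq : (r l / D l) ^ 2 * (∑ i, a l i ^ 2) / 2 ≤ r l ^ 2 / 2 := by
        have : (r l / D l) ^ 2 * (∑ i, a l i ^ 2) ≤ (r l / D l) ^ 2 * D l ^ 2 := by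
          gcongr
          exact ha l hl
        rw [← mul_pow, div_mul_cancel₀ _ (hD l hl).ne'] at this
        linarith
      have h1 := sum_exp_signs_le (a l) (r l / D l)
      have h2 := sum_exp_signs_le (a l) (-(r l / D l))
      rw [neg_sq] at h2
      have h3 := mul_le_mul_of_nonneg_left (Real.exp_le_exp.2 hq)
        (show (0 : ℝ) ≤ 2 ^ Fintype.card ι by positivity)
      have e : Real.exp (-(r l ^ 2 / 2)) = Real.exp (-(r l ^ 2)) * Real.exp (r l ^ 2 / 2) := by
        rw [← Real.exp_add]; ring_nf
      rw [e]
      calc _ ≤ Real.exp (-(r l ^ 2)) * (2 ^ Fintype.card ι * Real.exp (r l ^ 2 / 2) +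
            2 ^ Fintype.card ι * Real.exp (r l ^ 2 / 2)) :=
            mul_le_mul_of_nonneg_left (add_le_add (h1.trans h3) (h2.trans h3)) (Real.exp_pos _).le
        _ = _ := by ring
    rw [← Finset.mul_sum] at hF
    refine hF.trans_lt ?_
    have : (0 : ℝ) < 2 ^ Fintype.card ι := by positivity
    simp only [Finset.sum_const, Finset.card_univ, Fintype.card_pi, Fintype.card_bool,
      Finset.prod_const, nsmul_eq_mul, mul_one]
    push_cast
    nlinarith
  obtain ⟨ε, -, hε⟩ := Finset.exists_lt_of_sum_lt hsum
  refine ⟨ε, fun l hl => ?_⟩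
  have hterm : Real.exp (-(r l ^ 2)) *
      (Real.exp (r l / D l * Z l ε) + Real.exp (-(r l / D l) * Z l ε)) < 1 :=
    (Finset.single_le_sum (f := fun l => Real.exp (-(r l ^ 2)) *
      (Real.exp (r l / D l * Z l ε) + Real.exp (-(r l / D l) * Z l ε)))
      (fun _ _ => by positivity) hl).trans_lt hε
  rw [mul_add, ← Real.exp_add, ← Real.exp_add] at hterm
  have hDl := hD l hl
  have hrl := hr l hl
  have key : ∀ z : ℝ, Real.exp (-(r l ^ 2) + r l / D l * z) < 1 → z ≤ r l * D l := by
    intro z hz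
    rw [Real.exp_lt_one_iff] at hz
    have h : r l / D l * z < r l / D l * (r l * D l) := by
      calc r l / D l * z < r l ^ 2 := by linarith
        _ = _ := by field_simp
    exact (lt_of_mul_lt_mul_left h (by positivity)).le
  refine abs_le.2 ⟨?_, key _ (by linarith [Real.exp_pos (-(r l ^ 2) + -(r l / D l) * Z l ε)])⟩
  have := key (-Z l ε) (by
    rw [mul_neg, ← neg_mul]
    linarith [Real.exp_pos (-(r l ^ 2) + r l / D l * Z l ε)])
  linarith

end Signs

section Scales

lemma sum_decay_le (K₀ K : ℕ) :
    ∑ k ∈ Finset.range K, (9 / 10 : ℝ) ^ (k - K₀)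
      ≤ (min K K₀ : ℕ) + 10 * (1 - (9 / 10 : ℝ) ^ (K - K₀)) := by
  induction K with
  | zero => simp
  | succ K ih =>
    rw [Finset.sum_range_succ]
    rcases lt_or_ge K K₀ with h | h
    · rw [min_eq_left h.le, Nat.sub_eq_zero_of_le h.le] at ih
      rw [min_eq_left (Nat.succ_le_of_lt h), Nat.sub_eq_zero_of_le h.le,
        Nat.sub_eq_zero_of_le (Nat.succ_le_of_lt h)]
      push_cast
      linarith
    · rw [min_eq_right h] at ih
      rw [min_eq_right (h.trans K.le_succ), Nat.succ_sub h, pow_succ]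
      linarith

lemma sum_decay_le' (K₀ K : ℕ) :
    ∑ k ∈ Finset.range K, (9 / 10 : ℝ) ^ (k - K₀) ≤ K₀ + 10 := by
  have h1 : ((min K K₀ : ℕ) : ℝ) ≤ K₀ := by exact_mod_cast min_le_right _ _
  have h2 : (0 : ℝ) ≤ (9 / 10 : ℝ) ^ (K - K₀) := by positivity
  linarith [sum_decay_le K₀ K]

lemma one_le_localEntropy {p n t : ℝ} (hn : 2 ≤ n) (ht : 0 < t) (htn : t ^ p ≤ 4 * n) :
    1 ≤ localEntropy p n t := by
  have h := one_le_mul_min (by linarith) ht htn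
  have hlog : 1 / 2 ≤ Real.log n := by
    linarith [Real.log_le_log (by norm_num) hn, Real.log_two_gt_d9]
  rw [localEntropy]
  nlinarith

lemma localEntropy_mul_rpow (p n : ℝ) {t : ℝ} (ht : 0 < t) :
    localEntropy p n t * t ^ p = 21508 * (n * Real.log n) * min 1 (t ^ p) := by
  have htp : 0 < t ^ p := Real.rpow_pos_of_pos ht p
  rw [localEntropy, mul_assoc, min_mul_of_nonneg _ _ htp.le, ← Real.rpow_add ht, one_mul]
  simp

lemma entropy_mul_rpow_le {p n : ℝ} (hp1 : 1 < p) (hn : 2 ≤ n) (K₀ k : ℕ) :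
    (∑ j ∈ Finset.range (k + 1), localEntropy p n (2 ^ K₀ / 2 ^ j)) * (2 ^ K₀ / 2 ^ k) ^ p
      ≤ 4 * (21508 * (n * Real.log n)) * ((9 / 10 : ℝ) ^ (k - K₀)) ^ 2 := by
  have hlog : 0 ≤ Real.log n := Real.log_nonneg (by linarith)
  set A := 21508 * (n * Real.log n) with hA
  have hA0 : 0 ≤ A := by positivity
  induction k with
  | zero =>
    rw [zero_add, Finset.sum_range_one, localEntropy_mul_rpow _ _ (by positivity)]
    simp only [Nat.zero_sub, pow_zero, one_pow, mul_one]
    nlinarith [min_le_left (1 : ℝ) ((2 ^ K₀ / 1) ^ p)]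
  | succ k ih =>
    set H := ∑ j ∈ Finset.range (k + 1), localEntropy p n (2 ^ K₀ / 2 ^ j) with hH
    set t : ℝ := 2 ^ K₀ / 2 ^ k with ht
    have ht0 : 0 < t := by positivity
    have htk : (2 : ℝ) ^ K₀ / 2 ^ (k + 1) = t / 2 := by rw [ht, pow_succ, div_div]
    have hH0 : 0 ≤ H := by
      refine Finset.sum_nonneg fun j _ => ?_
      rw [localEntropy]
      have : 0 ≤ min (((2 : ℝ) ^ K₀ / 2 ^ j) ^ (-p)) 1 := le_min (by positivity) zero_le_one
      positivity
    have hhalf : (t / 2) ^ p ≤ t ^ p / 2 := by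
      rw [Real.div_rpow ht0.le (by norm_num)]
      have : (2 : ℝ) ≤ 2 ^ p := by
        simpa using Real.rpow_le_rpow_of_exponent_le (by norm_num : (1 : ℝ) ≤ 2) hp1.le
      gcongr
    rw [Finset.sum_range_succ, add_mul, localEntropy_mul_rpow _ _ (by positivity), ← hA, htk]
    have hrec : H * (t / 2) ^ p ≤ H * t ^ p / 2 := by
      rw [mul_div_assoc]
      gcongr
    rcases lt_or_ge k K₀ with h | h
    · rw [Nat.sub_eq_zero_of_le h.le] at ih
      rw [Nat.sub_eq_zero_of_le (Nat.succ_le_of_lt h)]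
      have := mul_le_mul_of_nonneg_left (min_le_left 1 ((t / 2) ^ p)) hA0
      simp only [pow_zero, one_pow, mul_one] at ih this ⊢
      linarith
    · rw [Nat.succ_sub h]
      obtain ⟨j, rfl⟩ := Nat.exists_eq_add_of_le h
      rw [Nat.add_sub_cancel_left] at ih ⊢
      rw [Nat.succ_eq_add_one, pow_succ (9 / 10 : ℝ) j]
      set s : ℝ := (9 / 10 : ℝ) ^ j with hs
      have hth : t / 2 = (1 / 2) ^ (j + 1) := by
        rw [ht, pow_add, one_div, inv_pow, pow_succ]
        field_simp
      have ht1 : t / 2 ≤ 1 := by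
        rw [hth]; exact pow_le_one₀ (by norm_num) (by norm_num)
      have htp : (t / 2) ^ p ≤ s ^ 2 := by
        calc (t / 2) ^ p ≤ (t / 2) ^ (1 : ℝ) :=
              Real.rpow_le_rpow_of_exponent_ge (by positivity) ht1 hp1.le
          _ = (1 / 2) ^ j * (1 / 2) := by rw [Real.rpow_one, hth, pow_succ]
          _ ≤ ((9 / 10) ^ 2) ^ j * 1 := by gcongr <;> norm_num
          _ = s ^ 2 := by rw [hs, mul_one, ← pow_mul, ← pow_mul, mul_comm]
      have h3 := mul_le_mul_of_nonneg_left ((min_le_right 1 ((t / 2) ^ p)).trans htp) hA0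
      have h4 : 0 ≤ A * s ^ 2 := by positivity
      nlinarith

/-- The number of dyadic scales. -/
lemma exists_scale {p n : ℝ} (hp1 : 1 < p) (hp2 : p < 2) (hn : 2 ≤ n) :
    ∃ K₀ : ℕ, n ≤ ((2 : ℝ) ^ K₀) ^ p ∧ ((2 : ℝ) ^ K₀) ^ p ≤ 4 * n ∧
      (K₀ : ℝ) + 10 ≤ 18 * Real.log n := by
  have hlog2 := Real.log_two_gt_d9
  have hlog : Real.log 2 ≤ Real.log n := Real.log_le_log (by norm_num) hn
  set l := Real.logb 2 n with hl
  have hl0 : 0 ≤ l := Real.logb_nonneg (by norm_num) (by linarith)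
  have hpow : (2 : ℝ) ^ l = n := Real.rpow_logb (by norm_num) (by norm_num) (by linarith)
  have hceil := Nat.le_ceil (l / p)
  have hceil' := Nat.ceil_lt_add_one (show 0 ≤ l / p by positivity)
  have hlp : l / p * p = l := div_mul_cancel₀ _ (by linarith)
  refine ⟨⌈l / p⌉₊, ?_, ?_, ?_⟩
  · rw [← Real.rpow_natCast, ← Real.rpow_mul (by norm_num)]
    calc n = 2 ^ l := hpow.symm
      _ ≤ _ := Real.rpow_le_rpow_of_exponent_le (by norm_num) (by nlinarith)
  · rw [← Real.rpow_natCast, ← Real.rpow_mul (by norm_num)]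
    calc (2 : ℝ) ^ ((⌈l / p⌉₊ : ℝ) * p) ≤ 2 ^ (2 + l) :=
          Real.rpow_le_rpow_of_exponent_le (by norm_num) (by nlinarith)
      _ = 4 * n := by rw [Real.rpow_add (by norm_num), hpow]; norm_num
  · have h1 : l / p ≤ l := div_le_self hl0 hp1.le
    have h2 : l ≤ 3 / 2 * Real.log n := by
      rw [hl, Real.logb, div_le_iff₀ (by linarith)]
      nlinarith
    linarith

end Scales

section Chaining

variable {E : Type*} [NormedAddCommGroup E] [InnerProductSpace ℝ E] {ι : Type*} [Fintype ι]

lemma abs_sign (b : Bool) : |sign b| = 1 := by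
  cases b <;> simp [sign]

lemma abs_sum_sign_mul_le {μ : ι → ℝ} (hμ : ∀ i, 0 ≤ μ i) (hμ1 : ∑ i, μ i ≤ 1) (d : ι → ℝ)
    (ε : ι → Bool) : |∑ i, sign (ε i) * (μ i * d i)| ≤ Real.sqrt (∑ i, μ i * d i ^ 2) := by
  have h0 : 0 ≤ ∑ i, μ i * d i ^ 2 :=
    Finset.sum_nonneg fun i _ => mul_nonneg (hμ i) (sq_nonneg _)
  refine Real.abs_le_sqrt ?_
  have h := Finset.sum_sq_le_sum_mul_sum_of_sq_le_mul Finset.univ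
    (r := fun i => sign (ε i) * (μ i * d i)) (f := μ) (g := fun i => μ i * d i ^ 2)
    (fun i _ => hμ i) (fun i _ => mul_nonneg (hμ i) (sq_nonneg _)) (fun i _ => by
      rw [mul_pow, ← sq_abs (sign _), abs_sign]
      exact le_of_eq (by ring))
  exact h.trans (mul_le_of_le_one_left h0 hμ1)

lemma two_mul_exp_le {N : ℝ} (hN : 100 ≤ N) : 2 * Real.exp (-(N / 24 / 2)) ≤ 1 / 2 := by
  have h1 : Real.exp (-(N / 24 / 2)) ≤ Real.exp (-2) := Real.exp_le_exp.2 (by linarith)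
  have h2 : (4 : ℝ) ≤ Real.exp 2 := by
    have h := Real.exp_one_gt_d9
    rw [show (2 : ℝ) = 1 + 1 by norm_num, Real.exp_add]
    nlinarith
  have h3 : Real.exp (-2) ≤ 1 / 4 := by
    rw [Real.exp_neg, ← one_div]
    exact one_div_le_one_div_of_le (by norm_num) h2
  linarith

lemma sum_exp_neg_lt (K : ℕ) :
    ∑ k ∈ Finset.range K, 2 * Real.exp (-4) * Real.exp (-((k : ℝ) + 1)) < 1 / 2 := by
  have h1 : Real.exp (-1) ≤ 1 / 2 := by
    rw [Real.exp_neg, ← one_div]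
    exact one_div_le_one_div_of_le (by norm_num) (by linarith [Real.exp_one_gt_d9])
  have h2 : ∀ k : ℕ, Real.exp (-((k : ℝ) + 1)) ≤ (1 / 2) ^ (k + 1) := fun k => by
    have : Real.exp (-((k : ℝ) + 1)) = Real.exp (-1) ^ (k + 1) := by
      rw [← Real.exp_nat_mul]; push_cast; ring_nf
    rw [this]
    gcongr
  have h3 : ∀ K : ℕ, ∑ k ∈ Finset.range K, (1 / 2 : ℝ) ^ (k + 1) = 1 - (1 / 2) ^ K := by
    intro K
    induction K with
    | zero => simp
    | succ K ih => rw [Finset.sum_range_succ, ih, pow_succ]; ring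
  have h4 : Real.exp (-4) ≤ 1 / 16 := by
    calc Real.exp (-4) = Real.exp (-1) ^ 4 := by rw [← Real.exp_nat_mul]; norm_num
      _ ≤ (1 / 2) ^ 4 := by gcongr
      _ = 1 / 16 := by norm_num
  rw [← Finset.mul_sum]
  have h5 : ∑ k ∈ Finset.range K, Real.exp (-((k : ℝ) + 1)) ≤ 1 := by
    refine (Finset.sum_le_sum fun k _ => h2 k).trans ?_
    rw [h3]
    have : (0 : ℝ) ≤ (1 / 2) ^ K := by positivity
    linarith
  have h6 := Real.exp_pos (-4)
  nlinarith

lemma abs_sum_sign_le_on_ball [FiniteDimensional ℝ E] [MeasurableSpace E] [BorelSpace E]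
    {p : ℝ} (hp1 : 1 < p) (hp2 : p < 2) {μ : ι → ℝ}
    (hμ : ∀ i, 0 ≤ μ i) (hμ1 : ∑ i, μ i ≤ 1) {u : ι → E} {n : ℝ} (hn : 2 ≤ n)
    (hu : ∀ i, ‖u i‖ ^ 2 ≤ n) (hframe : ∀ c, ‖c‖ ^ 2 ≤ ∑ i, μ i * ⟪u i, c⟫ ^ 2)
    {N : ℝ} (hN : 100 ≤ N) (hμN : ∀ i, μ i ≤ 2 / N) (hcard : (Fintype.card ι : ℝ) ≤ 3 / 2 * N) :
    ∃ ε : ι → Bool, |∑ i, sign (ε i)| ≤ N / 4 ∧ ∀ c, absMoment μ u p c ≤ 1 →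
      |∑ i, sign (ε i) * (μ i * |⟪u i, c⟫| ^ p)|
        ≤ 311401 * (Real.sqrt (n * Real.log n / N) * Real.log n) := by
  classical
  have hlog2 := Real.log_two_gt_d9
  have hlog : Real.log 2 ≤ Real.log n := Real.log_le_log (by norm_num) hn
  obtain ⟨K₀, hnT, hTn, hK₀⟩ := exists_scale hp1 hp2 hn
  set m : ℕ := ⌈Real.log n⌉₊ + 1 with hmdef
  have hm : Real.log n + 1 ≤ m := by
    rw [hmdef]; push_cast; linarith [Nat.le_ceil (Real.log n)]
  have hm' : (m : ℝ) ≤ 4 * Real.log n := by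
    rw [hmdef]; push_cast
    linarith [Nat.ceil_lt_add_one (show 0 ≤ Real.log n by linarith)]
  let t : ℕ → ℝ := fun k => 2 ^ K₀ / 2 ^ k
  have ht : ∀ k, 0 < t k := fun k => by positivity
  have htn : ∀ k, t k ^ p ≤ 4 * n := fun k =>
    (Real.rpow_le_rpow (ht k).le (div_le_self (by positivity) (one_le_pow₀ (by norm_num)))
      (by linarith)).trans hTn
  let H : ℕ → ℝ := fun k => ∑ j ∈ Finset.range k, localEntropy p n (t j)
  have hH : ∀ k : ℕ, (k : ℝ) ≤ H k := fun k => by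
    have := Finset.sum_le_sum fun j (_ : j ∈ Finset.range k) =>
      one_le_localEntropy (p := p) hn (ht j) (htn j)
    simpa using this
  choose T hT0 hTB hTcard hTnet using
    exists_nets hp1 hp2 hμ hμ1 hn hu hframe hm hm' (T := 2 ^ K₀) (by positivity) hnT hTn
  choose! π hπT hπ using hTnet
  set η : ℝ := Real.sqrt (n * Real.log n / N) * Real.log n with hη
  have hη0 : 0 < η := by
    have : 0 < n * Real.log n / N := div_pos (mul_pos (by linarith) (by linarith)) (by linarith)
    have := Real.sqrt_pos.2 this
    exact mul_pos this (by linarith)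
  obtain ⟨K, hK⟩ : ∃ K, 144 * t K ^ p ≤ η ^ 2 := by
    obtain ⟨j, hj⟩ := exists_pow_lt_of_lt_one (show 0 < η ^ 2 / 144 by positivity)
      (show (1 / 2 : ℝ) < 1 by norm_num)
    refine ⟨K₀ + j, ?_⟩
    have htj : t (K₀ + j) = (1 / 2) ^ j := by
      simp only [t]
      rw [pow_add, one_div, inv_pow]
      field_simp
    have : t (K₀ + j) ^ p ≤ t (K₀ + j) ^ (1 : ℝ) :=
      Real.rpow_le_rpow_of_exponent_ge (ht _)
        (by rw [htj]; exact pow_le_one₀ (by norm_num) (by norm_num)) hp1.le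
    rw [Real.rpow_one, htj] at this
    rw [htj]
    linarith
  let J : Finset (Option (Σ _ : ℕ, E)) :=
    Finset.insertNone ((Finset.range K).sigma fun k => T (k + 1))
  let a : Option (Σ _ : ℕ, E) → ι → ℝ := fun l => l.elim (fun _ => 1)
    fun q i => μ i * (|⟪u i, q.2⟫| ^ p - |⟪u i, π q.1 q.2⟫| ^ p)
  let D : Option (Σ _ : ℕ, E) → ℝ := fun l => l.elim (Real.sqrt (3 / 2 * N))
    fun q => Real.sqrt (288 * t q.1 ^ p / N)
  let r : Option (Σ _ : ℕ, E) → ℝ := fun l => l.elim (Real.sqrt (N / 24))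
    fun q => Real.sqrt (4 * H (q.1 + 1) + 8)
  have hH8 : ∀ k, 0 < 4 * H (k + 1) + 8 := fun k => by
    have := (Nat.cast_nonneg (k + 1)).trans (hH (k + 1))
    linarith
  have htp : ∀ k, 0 < t k ^ p := fun k => Real.rpow_pos_of_pos (ht k) p
  obtain ⟨ε, hε⟩ : ∃ ε : ι → Bool, ∀ l ∈ J, |∑ i, sign (ε i) * a l i| ≤ r l * D l := by
    refine exists_signs J a D r ?_ ?_ ?_ ?_
    · rintro (_ | q) -
      · exact Real.sqrt_pos.2 (by linarith)
      · exact Real.sqrt_pos.2 (div_pos (mul_pos (by norm_num) (htp _)) (by linarith))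
    · rintro (_ | q) -
      · exact Real.sqrt_pos.2 (by linarith)
      · exact Real.sqrt_pos.2 (hH8 _)
    · rintro (_ | ⟨k, x⟩) hq
      · simpa [a, D, Real.sq_sqrt (show 0 ≤ 3 / 2 * N by linarith)] using hcard
      · simp only [J, Finset.some_mem_insertNone, Finset.mem_sigma, Finset.mem_range] at hq
        have hxB := hTB (k + 1) x hq.2
        have hyB := hTB k _ (hπT k x hxB)
        have h := sum_rpow_sub_rpow_sq_le hp1 hp2 hμ (by linarith) hu hframe hm (ht k) hxB hyB
          (hπ k x hxB)
        have hNp : 0 < N := by linarith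
        simp only [a, D, Option.elim_some]
        rw [Real.sq_sqrt (div_nonneg (mul_nonneg (by norm_num) (htp k).le) hNp.le)]
        calc ∑ i, (μ i * (|⟪u i, x⟫| ^ p - |⟪u i, π k x⟫| ^ p)) ^ 2
            ≤ ∑ i, 2 / N * (μ i * (|⟪u i, x⟫| ^ p - |⟪u i, π k x⟫| ^ p) ^ 2) := by
              refine Finset.sum_le_sum fun i _ => ?_
              rw [mul_pow, sq (μ i), mul_assoc]
              exact mul_le_mul_of_nonneg_right (hμN i) (mul_nonneg (hμ i) (sq_nonneg _))
          _ ≤ 2 / N * (144 * t k ^ p) := by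
              rw [← Finset.mul_sum]
              gcongr
          _ = _ := by ring
    · rw [Finset.sum_insertNone, Finset.sum_sigma]
      simp only [r, Option.elim_none, Option.elim_some]
      rw [Real.sq_sqrt (by linarith)]
      have h1 := two_mul_exp_le hN
      have h2 : ∑ k ∈ Finset.range K, ∑ _x ∈ T (k + 1),
          2 * Real.exp (-(Real.sqrt (4 * H (k + 1) + 8) ^ 2 / 2)) ≤
          ∑ k ∈ Finset.range K, 2 * Real.exp (-4) * Real.exp (-((k : ℝ) + 1)) := by
        refine Finset.sum_le_sum fun k _ => ?_
        rw [Real.sq_sqrt (hH8 k).le, Finset.sum_const, nsmul_eq_mul]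
        have e : Real.exp (-((4 * H (k + 1) + 8) / 2))
            = Real.exp (-4) * (Real.exp (-H (k + 1)) * Real.exp (-H (k + 1))) := by
          rw [← Real.exp_add, ← Real.exp_add]; ring_nf
        have e2 : Real.exp (H (k + 1)) * Real.exp (-H (k + 1)) = 1 := by
          rw [← Real.exp_add, add_neg_cancel, Real.exp_zero]
        have e3 : Real.exp (-H (k + 1)) ≤ Real.exp (-((k : ℝ) + 1)) := by
          have := hH (k + 1)
          push_cast at this
          exact Real.exp_le_exp.2 (by linarith)
        calc ((T (k + 1)).card : ℝ) * (2 * Real.exp (-((4 * H (k + 1) + 8) / 2)))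
            ≤ Real.exp (H (k + 1)) * (2 * Real.exp (-((4 * H (k + 1) + 8) / 2))) := by
              gcongr
              exact hTcard (k + 1)
          _ = 2 * Real.exp (-4) * (Real.exp (H (k + 1)) * Real.exp (-H (k + 1)))
              * Real.exp (-H (k + 1)) := by rw [e]; ring
          _ ≤ 2 * Real.exp (-4) * Real.exp (-((k : ℝ) + 1)) := by
              rw [e2, mul_one]
              gcongr
      linarith [sum_exp_neg_lt K]
  let Z : E → ℝ := fun x => ∑ i, sign (ε i) * (μ i * |⟪u i, x⟫| ^ p)
  have hZsub : ∀ x y, Z x - Z y =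
      ∑ i, sign (ε i) * (μ i * (|⟪u i, x⟫| ^ p - |⟪u i, y⟫| ^ p)) := fun x y => by
    simp only [Z]
    rw [← Finset.sum_sub_distrib]
    exact Finset.sum_congr rfl fun i _ => by ring
  set q : ℝ := Real.sqrt (n * Real.log n / N) with hq
  have hstep : ∀ k < K, ∀ x ∈ T (k + 1),
      |Z x - Z (π k x)| ≤ 17300 * q * (9 / 10) ^ (k - K₀) := by
    intro k hk x hx
    have h := hε (some ⟨k, x⟩) (by simp [J, hk, hx])
    simp only [a, r, D, Option.elim_some] at h
    rw [hZsub]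
    refine h.trans ?_
    rw [← Real.sqrt_mul (hH8 k).le]
    have hNp : 0 < N := by linarith
    have hG := entropy_mul_rpow_le hp1 hn K₀ k
    have hH1 : 1 ≤ H (k + 1) := by
      have := hH (k + 1)
      push_cast at this
      linarith [(Nat.cast_nonneg k : (0 : ℝ) ≤ k)]
    have hnl : 0 ≤ n * Real.log n / N := div_nonneg (mul_nonneg (by linarith) (by linarith)) hNp.le
    refine Real.sqrt_le_iff.2 ⟨by positivity, ?_⟩
    rw [mul_pow, mul_pow, hq, Real.sq_sqrt hnl]
    calc (4 * H (k + 1) + 8) * (288 * t k ^ p / N)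
        ≤ (12 * H (k + 1)) * (288 * t k ^ p / N) := by
          gcongr
          linarith
      _ = 3456 * (H (k + 1) * t k ^ p) / N := by ring
      _ ≤ 3456 * (4 * (21508 * (n * Real.log n)) * ((9 / 10 : ℝ) ^ (k - K₀)) ^ 2) / N := by
          gcongr
      _ = 297326592 * (n * Real.log n / N) * ((9 / 10 : ℝ) ^ (k - K₀)) ^ 2 := by ring
      _ ≤ 17300 ^ 2 * (n * Real.log n / N) * ((9 / 10 : ℝ) ^ (k - K₀)) ^ 2 := by
          gcongr
          norm_num
  have hchain : ∀ k ≤ K, ∀ x ∈ T k,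
      |Z x| ≤ 17300 * q * ∑ j ∈ Finset.range k, (9 / 10 : ℝ) ^ (j - K₀) := by
    intro k
    induction k with
    | zero =>
      intro _ x hx
      rw [hT0 0 rfl, Finset.mem_singleton] at hx
      simp [hx, Z, Real.zero_rpow (by linarith : p ≠ 0)]
    | succ k ih =>
      intro hk x hx
      have h1 := ih (by omega) _ (hπT k x (hTB _ x hx))
      have h2 := hstep k (by omega) x hx
      rw [Finset.sum_range_succ, mul_add]
      calc |Z x| = |Z (π k x) + (Z x - Z (π k x))| := by ring_nf
        _ ≤ |Z (π k x)| + |Z x - Z (π k x)| := abs_add_le _ _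
        _ ≤ _ := add_le_add h1 h2
  refine ⟨ε, ?_, fun c hc => ?_⟩
  · have h := hε none (by simp [J])
    simp only [a, r, D, Option.elim_none, mul_one] at h
    refine h.trans_eq ?_
    rw [← Real.sqrt_mul (by linarith), show N / 24 * (3 / 2 * N) = (N / 4) ^ 2 by ring,
      Real.sqrt_sq (by linarith)]
  · have hyB := hπT K c hc
    have h1 := hchain K le_rfl _ hyB
    have h2 : |Z c - Z (π K c)| ≤ η := by
      rw [hZsub]
      refine (abs_sum_sign_mul_le hμ hμ1 _ ε).trans (Real.sqrt_le_iff.2 ⟨hη0.le, ?_⟩)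
      exact (sum_rpow_sub_rpow_sq_le hp1 hp2 hμ (by linarith) hu hframe hm (ht K) hc
        (hTB K _ hyB) (hπ K c hc)).trans hK
    have h3 : 17300 * q * ∑ j ∈ Finset.range K, (9 / 10 : ℝ) ^ (j - K₀) ≤ 311400 * η := by
      calc _ ≤ 17300 * q * (18 * Real.log n) := by
            gcongr
            exact (sum_decay_le' K₀ K).trans hK₀
        _ = 311400 * η := by rw [hη]; ring
    calc |Z c| = |Z (π K c) + (Z c - Z (π K c))| := by ring_nf
      _ ≤ |Z (π K c)| + |Z c - Z (π K c)| := abs_add_le _ _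
      _ ≤ 311401 * η := by linarith

lemma absMoment_smul {p r : ℝ} (hr : 0 ≤ r) (μ : ι → ℝ) (u : ι → E) (c : E) :
    absMoment μ u p (r • c) = r ^ p * absMoment μ u p c := by
  simp only [absMoment, Finset.mul_sum]
  refine Finset.sum_congr rfl fun i _ => ?_
  rw [real_inner_smul_right, abs_mul, abs_of_nonneg hr, Real.mul_rpow hr (abs_nonneg _)]
  ring

/-- A balanced choice of signs which almost halves all the `L_p` norms. -/
theorem exists_balanced_signs [FiniteDimensional ℝ E] [MeasurableSpace E] [BorelSpace E]
    {p : ℝ} (hp1 : 1 < p) (hp2 : p < 2) {μ : ι → ℝ}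
    (hμ : ∀ i, 0 ≤ μ i) (hμ1 : ∑ i, μ i ≤ 1) {u : ι → E} {n : ℝ} (hn : 2 ≤ n)
    (hu : ∀ i, ‖u i‖ ^ 2 ≤ n) (hframe : ∀ c, ‖c‖ ^ 2 ≤ ∑ i, μ i * ⟪u i, c⟫ ^ 2)
    {N : ℝ} (hN : 100 ≤ N) (hμN : ∀ i, μ i ≤ 2 / N) (hcard : (Fintype.card ι : ℝ) ≤ 3 / 2 * N) :
    ∃ ε : ι → Bool, |∑ i, sign (ε i)| ≤ N / 4 ∧ ∀ c,
      |∑ i, sign (ε i) * (μ i * |⟪u i, c⟫| ^ p)|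
        ≤ 311401 * (Real.sqrt (n * Real.log n / N) * Real.log n) * absMoment μ u p c := by
  obtain ⟨ε, hε, h⟩ := abs_sum_sign_le_on_ball hp1 hp2 hμ hμ1 hn hu hframe hN hμN hcard
  refine ⟨ε, hε, fun c => ?_⟩
  rcases eq_or_lt_of_le (absMoment_nonneg hμ u p c) with h0 | h0
  · rw [← h0, mul_zero]
    have hz := (Finset.sum_eq_zero_iff_of_nonneg fun i _ =>
      mul_nonneg (hμ i) (Real.rpow_nonneg (abs_nonneg _) p)).1 h0.symm
    rw [Finset.sum_eq_zero fun i hi => by rw [hz i hi, mul_zero], abs_zero]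
  set w := absMoment μ u p c with hw
  have hwp : (w ^ (-p⁻¹)) ^ p = w⁻¹ := by
    rw [← Real.rpow_mul h0.le, neg_mul, inv_mul_cancel₀ (by linarith), Real.rpow_neg_one]
  have hr : 0 ≤ w ^ (-p⁻¹) := by positivity
  have h1 := h (w ^ (-p⁻¹) • c) (by
    rw [absMoment_smul hr, hwp, ← hw, inv_mul_cancel₀ h0.ne'])
  have h2 : ∑ i, sign (ε i) * (μ i * |⟪u i, w ^ (-p⁻¹) • c⟫| ^ p)
      = w⁻¹ * ∑ i, sign (ε i) * (μ i * |⟪u i, c⟫| ^ p) := by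
    rw [Finset.mul_sum]
    refine Finset.sum_congr rfl fun i _ => ?_
    rw [real_inner_smul_right, abs_mul, abs_of_nonneg hr, Real.mul_rpow hr (abs_nonneg _), hwp]
    ring
  rw [h2, abs_mul, abs_of_pos (inv_pos.2 h0), inv_mul_le_iff₀ h0] at h1
  linarith

end Chaining

section Lewis

variable {E : Type*} [NormedAddCommGroup E] [InnerProductSpace ℝ E]

lemma norm_add_smul_sq {e b : E} (he : ‖e‖ = 1) (s : ℝ) :
    ‖b + ⟪e, b⟫ • s • e‖ ^ 2 = ‖b‖ ^ 2 + (2 * s + s ^ 2) * ⟪b, e⟫ ^ 2 := by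
  rw [norm_add_sq_real, inner_smul_right, inner_smul_right, norm_smul, norm_smul, he,
    real_inner_comm, mul_one, mul_pow, Real.norm_eq_abs, Real.norm_eq_abs, sq_abs, sq_abs]
  ring

lemma norm_add_smul_rpow_le {p : ℝ} (hp0 : 0 < p) (hp2 : p ≤ 2) {e b : E} (he : ‖e‖ = 1) {s : ℝ}
    (hs : 0 ≤ s) : ‖b + ⟪e, b⟫ • s • e‖ ^ p
      ≤ ‖b‖ ^ p + p / 2 * (2 * s + s ^ 2) * (‖b‖ ^ (p - 2) * ⟪b, e⟫ ^ 2) := by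
  rcases eq_or_ne b 0 with rfl | hb
  · simp [Real.zero_rpow hp0.ne']
  have hb0 : 0 < ‖b‖ := norm_pos_iff.2 hb
  have h0 : ‖b + ⟪e, b⟫ • s • e‖ ^ p = (‖b + ⟪e, b⟫ • s • e‖ ^ 2) ^ (p / 2) := by
    rw [← Real.rpow_natCast, ← Real.rpow_mul (norm_nonneg _)]
    congr 1
    push_cast
    ring
  have h1 : ‖b‖ ^ 2 + (2 * s + s ^ 2) * ⟪b, e⟫ ^ 2
      = ‖b‖ ^ 2 * (1 + (2 * s + s ^ 2) * ⟪b, e⟫ ^ 2 / ‖b‖ ^ 2) := by field_simp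
  have h2 : (‖b‖ ^ 2) ^ (p / 2) = ‖b‖ ^ p := by
    rw [← Real.rpow_natCast, ← Real.rpow_mul (norm_nonneg _)]
    congr 1
    push_cast
    ring
  have h3 : 0 ≤ (2 * s + s ^ 2) * ⟪b, e⟫ ^ 2 / ‖b‖ ^ 2 := by positivity
  have h4 : ‖b‖ ^ (p - 2) = ‖b‖ ^ p / ‖b‖ ^ 2 := by
    rw [Real.rpow_sub hb0, Real.rpow_two]
  rw [h0, norm_add_smul_sq he, h1, Real.mul_rpow (by positivity) (by linarith), h2, h4]
  calc ‖b‖ ^ p * (1 + (2 * s + s ^ 2) * ⟪b, e⟫ ^ 2 / ‖b‖ ^ 2) ^ (p / 2)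
      ≤ ‖b‖ ^ p * (1 + p / 2 * ((2 * s + s ^ 2) * ⟪b, e⟫ ^ 2 / ‖b‖ ^ 2)) := by
        gcongr
        exact rpow_one_add_le_one_add_mul_self (by linarith) (by linarith) (by linarith)
    _ = _ := by ring

variable [FiniteDimensional ℝ E] {κ : Type*} [Fintype κ]

lemma exists_max_det {p : ℝ} (hp : 0 < p) {a : κ → E} (ha : ∀ c, (∀ i, ⟪a i, c⟫ = 0) → c = 0) :
    ∃ B : E →ₗ[ℝ] E, LinearMap.det B ≠ 0 ∧ ∑ j, ‖B (a j)‖ ^ p ≤ 1 ∧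
      ∀ B' : E →ₗ[ℝ] E, ∀ Q : ℝ, 0 < Q → ∑ j, ‖B' (a j)‖ ^ p ≤ Q →
        |LinearMap.det B'| ≤ Q ^ (Module.finrank ℝ E / p) * |LinearMap.det B| := by
  have hspan : Submodule.span ℝ (Set.range a) = ⊤ := by
    rw [← Submodule.orthogonal_eq_bot_iff, Submodule.eq_bot_iff]
    exact fun c hc => ha c fun i =>
      (Submodule.mem_orthogonal _ _).1 hc _ (Submodule.subset_span (Set.mem_range_self i))
  let Φ : (E →L[ℝ] E) →ₗ[ℝ] (κ → E) :=
    { toFun := fun B j => B (a j), map_add' := fun _ _ => rfl, map_smul' := fun _ _ => rfl }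
  have hΦ : LinearMap.ker Φ = ⊥ := by
    rw [LinearMap.ker_eq_bot]
    intro B B' h
    ext x
    have hx : x ∈ Submodule.span ℝ (Set.range a) := hspan ▸ Submodule.mem_top
    refine LinearMap.eqOn_span (f := B.toLinearMap) (g := B'.toLinearMap) ?_ hx
    rintro _ ⟨i, rfl⟩
    exact congrFun h i
  have hcont : Continuous fun v : κ → E => ∑ j, ‖v j‖ ^ p :=
    continuous_finsetSum _ fun j _ =>
      ((continuous_apply j).norm).rpow_const fun _ => Or.inr hp.le
  have hK : IsCompact {v : κ → E | ∑ j, ‖v j‖ ^ p ≤ 1} := by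
    refine Metric.isCompact_of_isClosed_isBounded (isClosed_le hcont continuous_const) ?_
    refine (Metric.isBounded_closedBall (x := (0 : κ → E)) (r := 1)).subset fun v hv => ?_
    rw [mem_closedBall_zero_iff, pi_norm_le_iff_of_nonneg zero_le_one]
    intro j
    have h := (Finset.single_le_sum (f := fun j => ‖v j‖ ^ p)
      (fun j _ => Real.rpow_nonneg (norm_nonneg _) p) (Finset.mem_univ j)).trans hv
    by_contra! h1
    exact absurd h (not_le.2 (Real.one_lt_rpow h1 hp))
  have hC : IsCompact {B : E →L[ℝ] E | ∑ j, ‖B (a j)‖ ^ p ≤ 1} :=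
    (LinearMap.isClosedEmbedding_of_injective hΦ).isCompact_preimage hK
  obtain ⟨B, hB, hmax⟩ := hC.exists_isMaxOn (f := fun B : E →L[ℝ] E => |B.det|)
    ⟨0, by simp [Real.zero_rpow hp.ne']⟩ ContinuousLinearMap.continuous_det.abs.continuousOn
  have key : ∀ B' : E →ₗ[ℝ] E, ∀ Q : ℝ, 0 < Q → ∑ j, ‖B' (a j)‖ ^ p ≤ Q →
      |LinearMap.det B'| ≤ Q ^ (Module.finrank ℝ E / p) * |B.det| := by
    intro B' Q hQ hB'
    set r := Q ^ (-p⁻¹) with hr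
    have hr0 : 0 < r := Real.rpow_pos_of_pos hQ _
    have hrp : r ^ p = Q⁻¹ := by
      rw [hr, ← Real.rpow_mul hQ.le, neg_mul, inv_mul_cancel₀ hp.ne', Real.rpow_neg_one]
    have hmem : LinearMap.toContinuousLinearMap (r • B') ∈
        {B : E →L[ℝ] E | ∑ j, ‖B (a j)‖ ^ p ≤ 1} := by
      simp only [Set.mem_ofPred_eq, LinearMap.coe_toContinuousLinearMap', LinearMap.smul_apply,
        norm_smul, Real.norm_of_nonneg hr0.le, Real.mul_rpow hr0.le (norm_nonneg _), hrp]
      rw [← Finset.mul_sum, inv_mul_le_iff₀ hQ, mul_one]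
      exact hB'
    have h := hmax hmem
    simp only [Set.mem_ofPred_eq, ContinuousLinearMap.det,
      LinearMap.coe_toContinuousLinearMap, LinearMap.det_smul, abs_mul, abs_pow,
      abs_of_pos hr0] at h
    have hrd : Q ^ (Module.finrank ℝ E / p) * r ^ Module.finrank ℝ E = 1 := by
      rw [← Real.rpow_natCast, hr, ← Real.rpow_mul hQ.le, ← Real.rpow_add hQ,
        show (Module.finrank ℝ E : ℝ) / p + -p⁻¹ * Module.finrank ℝ E = 0 by ring, Real.rpow_zero]
    calc |LinearMap.det B'|
        = Q ^ (Module.finrank ℝ E / p) * (r ^ Module.finrank ℝ E * |LinearMap.det B'|) := by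
          rw [← mul_assoc, hrd, one_mul]
      _ ≤ _ := by
          gcongr
  refine ⟨B, ?_, hB, key⟩
  intro h0
  have hpos : 0 < ∑ j, ‖a j‖ ^ p + 1 :=
    add_pos_of_nonneg_of_pos
      (Finset.sum_nonneg fun j _ => Real.rpow_nonneg (norm_nonneg (a j)) p) one_pos
  have h := key LinearMap.id _ hpos (by simp)
  rw [ContinuousLinearMap.det, h0] at h
  simp at h
  norm_num at h

/-- Lewis' position: a change of variables in which the weighted Gram operator dominates the
identity. -/
theorem exists_lewis {p : ℝ} (hp0 : 0 < p) (hp2 : p ≤ 2) {a : κ → E}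
    (ha : ∀ c, (∀ i, ⟪a i, c⟫ = 0) → c = 0) :
    ∃ B : E →ₗ[ℝ] E, LinearMap.det B ≠ 0 ∧ ∑ j, ‖B (a j)‖ ^ p ≤ 1 ∧
      ∀ e : E, ‖e‖ ^ 2
        ≤ Module.finrank ℝ E * ∑ j, ‖B (a j)‖ ^ (p - 2) * ⟪B (a j), e⟫ ^ 2 := by
  obtain ⟨B, hdet, hB, hmax⟩ := exists_max_det hp0 ha
  refine ⟨B, hdet, hB, ?_⟩
  set d : ℝ := (Module.finrank ℝ E : ℝ)
  have hunit : ∀ e : E, ‖e‖ = 1 →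
      1 ≤ d * ∑ j, ‖B (a j)‖ ^ (p - 2) * ⟪B (a j), e⟫ ^ 2 := by
    intro e he
    set θ := ∑ j, ‖B (a j)‖ ^ (p - 2) * ⟪B (a j), e⟫ ^ 2 with hθ
    have hθ0 : 0 ≤ θ := Finset.sum_nonneg fun j _ => by positivity
    have hd0 : 0 ≤ d := Nat.cast_nonneg _
    by_contra! hlt
    set s := 1 - d * θ with hs
    have hs0 : 0 < s := by linarith
    set f : Module.Dual ℝ E := (innerSL ℝ e).toLinearMap with hf
    have hQ0 : 0 ≤ p / 2 * (2 * s + s ^ 2) * θ := by positivity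
    have h := hmax (LinearMap.transvection f (s • e) ∘ₗ B) (1 + p / 2 * (2 * s + s ^ 2) * θ)
      (by linarith) (by
        calc ∑ j, ‖(LinearMap.transvection f (s • e) ∘ₗ B) (a j)‖ ^ p
            ≤ ∑ j, (‖B (a j)‖ ^ p +
              p / 2 * (2 * s + s ^ 2) * (‖B (a j)‖ ^ (p - 2) * ⟪B (a j), e⟫ ^ 2)) :=
              Finset.sum_le_sum fun j _ => norm_add_smul_rpow_le hp0 hp2 he hs0.le
          _ ≤ _ := by
              rw [Finset.sum_add_distrib, ← Finset.mul_sum]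
              linarith)
    have hfe : f (s • e) = s := by
      simp [hf, he]
    rw [LinearMap.det_comp, LinearMap.transvection.det, hfe, abs_mul,
      mul_le_mul_iff_left₀ (abs_pos.2 hdet), abs_of_pos (by linarith)] at h
    have h1 : 1 + s ≤ Real.exp (d / 2 * (2 * s + s ^ 2) * θ) := by
      calc 1 + s ≤ (1 + p / 2 * (2 * s + s ^ 2) * θ) ^ (d / p) := h
        _ ≤ Real.exp (p / 2 * (2 * s + s ^ 2) * θ) ^ (d / p) := by
            gcongr
            rw [add_comm]
            exact Real.add_one_le_exp _
        _ = _ := by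
            rw [← Real.exp_mul]
            congr 1
            field_simp
    have h2 := (Real.le_log_one_add_of_nonneg hs0.le).trans
      ((Real.log_le_iff_le_exp (by linarith)).2 h1)
    rw [div_le_iff₀ (by linarith)] at h2
    have h3 : 4 ≤ d * θ * (s + 2) ^ 2 := by
      refine le_of_mul_le_mul_left ?_ hs0
      nlinarith
    have h4 : d * θ = 1 - s := by rw [hs]; ring
    rw [h4] at h3
    nlinarith [sq_nonneg s, mul_pos hs0 hs0]
  intro e
  rcases eq_or_ne e 0 with rfl | he
  · simp
  have he0 : 0 < ‖e‖ := norm_pos_iff.2 he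
  have h := hunit (‖e‖⁻¹ • e) (by rw [norm_smul, norm_inv, norm_norm, inv_mul_cancel₀ he0.ne'])
  have h2 : ∑ j, ‖B (a j)‖ ^ (p - 2) * ⟪B (a j), ‖e‖⁻¹ • e⟫ ^ 2
      = (‖e‖ ^ 2)⁻¹ * ∑ j, ‖B (a j)‖ ^ (p - 2) * ⟪B (a j), e⟫ ^ 2 := by
    rw [Finset.mul_sum]
    refine Finset.sum_congr rfl fun j _ => ?_
    rw [real_inner_smul_right, mul_pow, inv_pow]
    ring
  rw [h2, mul_left_comm, le_inv_mul_iff₀ (by positivity), mul_one] at h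
  exact h

end Lewis

section Subspace

variable {κ : Type*} [Fintype κ]

/-- Every subspace of `ℝ^κ` is, up to a change of density, in Lewis' position. -/
theorem exists_lewis_subspace {p : ℝ} (hp0 : 0 < p) (hp2 : p ≤ 2) (V : Submodule ℝ (κ → ℝ)) :
    ∃ (μ : κ → ℝ) (u : κ → EuclideanSpace ℝ (Fin (Module.finrank ℝ V))) (w : ℝ),
      (∀ j, 0 ≤ μ j) ∧ ∑ j, μ j ≤ 1 ∧ (∀ j, ‖u j‖ ^ 2 ≤ Module.finrank ℝ V) ∧
      (∀ c, ‖c‖ ^ 2 ≤ ∑ j, μ j * ⟪u j, c⟫ ^ 2) ∧ 0 ≤ w ∧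
      ∀ x ∈ V, ∃ c, ∀ j, |x j| ^ p = w * (μ j * |⟪u j, c⟫| ^ p) := by
  set d := Module.finrank ℝ V with hd
  let E := EuclideanSpace ℝ (Fin d)
  let T : E ≃ₗ[ℝ] V := LinearEquiv.ofFinrankEq E V (by simp [E, hd])
  let φ : κ → E →L[ℝ] ℝ := fun j =>
    LinearMap.toContinuousLinearMap (LinearMap.proj j ∘ₗ V.subtype ∘ₗ T.toLinearMap)
  let a : κ → E := fun j => (InnerProductSpace.toDual ℝ E).symm (φ j)
  have ha : ∀ j c, ⟪a j, c⟫ = (T c : κ → ℝ) j := fun j c =>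
    InnerProductSpace.toDual_symm_apply
  obtain ⟨B, hdet, hB, hframe⟩ := exists_lewis hp0 hp2 (a := a) (fun c hc => by
    have : T c = 0 := Subtype.ext (funext fun j => by simpa [ha] using hc j)
    simpa using this)
  let b : κ → E := fun j => B (a j)
  have hfin : Module.finrank ℝ E = d := by simp [E]
  have hb : ∀ j c, b j ≠ 0 → 0 < (d : ℝ) ∧ ⟪(Real.sqrt d / ‖b j‖) • b j, c⟫
      = Real.sqrt d / ‖b j‖ * ⟪b j, c⟫ := by
    intro j c hj
    refine ⟨?_, real_inner_smul_left _ _ _⟩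
    have : Nontrivial E := ⟨⟨b j, 0, hj⟩⟩
    exact_mod_cast hfin ▸ Module.finrank_pos (R := ℝ) (M := E)
  refine ⟨fun j => ‖b j‖ ^ p, fun j => (Real.sqrt d / ‖b j‖) • b j, (Real.sqrt d ^ p)⁻¹,
    fun j => Real.rpow_nonneg (norm_nonneg _) p, hB, fun j => ?_, fun c => ?_, by positivity,
    fun x hx => ?_⟩
  · rw [norm_smul, norm_div, norm_norm, mul_pow, div_pow, Real.norm_eq_abs, sq_abs,
      Real.sq_sqrt (Nat.cast_nonneg _)]
    rcases eq_or_ne ‖b j‖ 0 with h | h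
    · simp [h]
    · exact (div_mul_cancel₀ _ (pow_ne_zero 2 h)).le
  · refine (hframe c).trans_eq ?_
    rw [hfin, Finset.mul_sum]
    refine Finset.sum_congr rfl fun j _ => ?_
    change (d : ℝ) * (‖b j‖ ^ (p - 2) * ⟪b j, c⟫ ^ 2) = _
    rcases eq_or_ne (b j) 0 with hj | hj
    · simp [hj]
    · have hj0 : 0 < ‖b j‖ := norm_pos_iff.2 hj
      rw [(hb j c hj).2, mul_pow, div_pow, Real.sq_sqrt (Nat.cast_nonneg _), Real.rpow_sub hj0,
        Real.rpow_two]
      field_simp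
  · let Be : E ≃ₗ[ℝ] E := LinearEquiv.ofIsUnitDet (f := B) (v := Module.finBasis ℝ E)
      (v' := Module.finBasis ℝ E) (by rw [LinearMap.det_toMatrix]; exact isUnit_iff_ne_zero.2 hdet)
    have hBe : ∀ z, Be.symm (B z) = z := fun z => Be.symm_apply_apply z
    refine ⟨LinearMap.adjoint Be.symm.toLinearMap (T.symm ⟨x, hx⟩), fun j => ?_⟩
    set c := LinearMap.adjoint Be.symm.toLinearMap (T.symm ⟨x, hx⟩) with hc
    have hxj : x j = ⟪b j, c⟫ := by
      rw [hc, LinearMap.adjoint_inner_right]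
      change x j = ⟪Be.symm (B (a j)), T.symm ⟨x, hx⟩⟫
      rw [hBe, ha, LinearEquiv.apply_symm_apply]
    rw [hxj]
    rcases eq_or_ne (b j) 0 with hj | hj
    · simp [hj, Real.zero_rpow hp0.ne']
    · have hj0 : 0 < ‖b j‖ := norm_pos_iff.2 hj
      obtain ⟨hd0, h⟩ := hb j c hj
      have hs : 0 < Real.sqrt d := Real.sqrt_pos.2 hd0
      have hs' : 0 < Real.sqrt d ^ p := Real.rpow_pos_of_pos hs p
      have hj' : 0 < ‖b j‖ ^ p := Real.rpow_pos_of_pos hj0 p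
      rw [h, abs_mul, abs_of_pos (div_pos hs hj0), Real.mul_rpow (by positivity) (abs_nonneg _),
        Real.div_rpow hs.le hj0.le]
      field_simp

end Subspace

section Splitting

lemma exists_map_card_fiber {N : ℕ} (m : Fin N → ℕ) :
    ∃ σ : Fin (∑ j, m j) → Fin N,
      ∀ j, (Finset.univ.filter fun i => σ i = j).card = m j := by
  refine ⟨fun i => (finSigmaFinEquiv.symm i).1, fun j => ?_⟩
  rw [← Fintype.card_subtype, Fintype.card_congr
    ((finSigmaFinEquiv.symm.subtypeEquiv (q := fun s => s.1 = j) fun i => Iff.rfl).trans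
      (Equiv.sigmaSubtype j))]
  simp

lemma sum_comp_eq_sum_mul {M N : ℕ} {σ : Fin M → Fin N} {m : Fin N → ℕ}
    (hσ : ∀ j, (Finset.univ.filter fun i => σ i = j).card = m j) (f : Fin N → ℝ) :
    ∑ i, f (σ i) = ∑ j, m j * f j := by
  rw [← Finset.sum_fiberwise' Finset.univ σ f]
  refine Finset.sum_congr rfl fun j _ => ?_
  rw [Finset.sum_const, hσ, nsmul_eq_mul]

lemma two_mul_sum_filter_sign {ι : Type*} [Fintype ι] (ε : ι → Bool) (b : Bool) (f : ι → ℝ) :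
    2 * ∑ i ∈ Finset.univ.filter (fun i => ε i = b), f i
      = ∑ i, f i + sign b * ∑ i, sign (ε i) * f i := by
  rw [Finset.sum_filter, Finset.mul_sum, Finset.mul_sum, ← Finset.sum_add_distrib]
  refine Finset.sum_congr rfl fun i _ => ?_
  cases b <;> cases ε i <;> simp [sign] <;> ring

lemma two_mul_sum_filter_sign_le {ι : Type*} [Fintype ι] (ε : ι → Bool) (b : Bool) {f : ι → ℝ}
    {B : ℝ} (h : |∑ i, sign (ε i) * f i| ≤ B) :
    2 * ∑ i ∈ Finset.univ.filter (fun i => ε i = b), f i ≤ ∑ i, f i + B := by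
  rw [two_mul_sum_filter_sign]
  have : |sign b * ∑ i, sign (ε i) * f i| ≤ B := by rwa [abs_mul, abs_sign, one_mul]
  linarith [le_abs_self (sign b * ∑ i, sign (ε i) * f i)]

theorem exists_splitting {p : ℝ} (hp1 : 1 < p) (hp2 : p < 2) {n N : ℕ} (hn : 2 ≤ n)
    (hN : 100 ≤ N) {τ : Fin N → ℝ} (hτ : ∀ j, 0 ≤ τ j) (hτ1 : ∑ j, τ j = 1)
    (X : Submodule ℝ (Fin N → ℝ)) (hX : Module.finrank ℝ X = n) :
    ∃ (M : ℕ) (ν : Fin M → ℝ) (σ : Fin M → Fin N) (M₁ : Finset (Fin M)),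
      N ≤ M ∧ (M : ℝ) ≤ 3 / 2 * N ∧
      (∀ i, 0 ≤ ν i) ∧ ∑ i, ν i = 1 ∧
      Function.Surjective σ ∧
      (∀ j, ∑ i ∈ Finset.univ.filter (fun i => σ i = j), ν i = τ j) ∧
      (M₁.card : ℝ) ≤ 7 / 8 * N ∧ ((M₁ᶜ : Finset (Fin M)).card : ℝ) ≤ 7 / 8 * N ∧
      ∀ x ∈ X, ∀ S ∈ ({M₁, M₁ᶜ} : Set (Finset (Fin M))),
        ∑ i ∈ S, ν i * |x (σ i)| ^ p ≤
          (1 / 2 + 311401 * (Real.sqrt (n * Real.log n / N) * Real.log n)) *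
            ∑ i, ν i * |x (σ i)| ^ p := by
  have hNR : (100 : ℝ) ≤ N := by exact_mod_cast hN
  let L : (Fin N → ℝ) →ₗ[ℝ] (Fin N → ℝ) :=
    { toFun := fun x j => τ j ^ p⁻¹ * x j
      map_add' := fun x y => funext fun j => mul_add _ _ _
      map_smul' := fun r x => funext fun j => mul_left_comm _ _ _ }
  have hL : ∀ x j, |L x j| ^ p = τ j * |x j| ^ p := fun x j => by
    change |τ j ^ p⁻¹ * x j| ^ p = _
    have h0 : 0 ≤ τ j ^ p⁻¹ := Real.rpow_nonneg (hτ j) _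
    rw [abs_mul, abs_of_nonneg h0, Real.mul_rpow h0 (abs_nonneg _), ← Real.rpow_mul (hτ j),
      inv_mul_cancel₀ (by linarith), Real.rpow_one]
  obtain ⟨μ, u, w, hμ, hμ1, hu, hframe, hw, hV⟩ :=
    exists_lewis_subspace (by linarith) hp2.le (X.map L)
  have hd : (Module.finrank ℝ (X.map L) : ℝ) ≤ n := by
    exact_mod_cast hX ▸ Submodule.finrank_map_le L X
  let m : Fin N → ℕ := fun j => max 1 ⌈μ j * N / 2⌉₊
  have hm1 : ∀ j, 1 ≤ m j := fun j => le_max_left _ _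
  have hm0 : ∀ j, (0 : ℝ) < m j := fun j => by exact_mod_cast hm1 j
  have hmμ : ∀ j, μ j * N / 2 ≤ m j := fun j =>
    (Nat.le_ceil _).trans (by exact_mod_cast le_max_right _ _)
  have hmle : ∀ j, (m j : ℝ) ≤ 1 + μ j * N / 2 := fun j => by
    have h0 : 0 ≤ μ j * N / 2 := div_nonneg (mul_nonneg (hμ j) (by linarith)) (by norm_num)
    simp only [m]
    push_cast
    exact max_le (by linarith) (by linarith [Nat.ceil_lt_add_one h0])
  obtain ⟨σ, hσ⟩ := exists_map_card_fiber m
  have hM : ((∑ j, m j : ℕ) : ℝ) ≤ 3 / 2 * N := by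
    push_cast
    calc ∑ j, (m j : ℝ) ≤ ∑ j, (1 + μ j * N / 2) := Finset.sum_le_sum fun j _ => hmle j
      _ = N + (∑ j, μ j) * N / 2 := by
          rw [Finset.sum_add_distrib, Finset.sum_mul, Finset.sum_div]
          simp
      _ ≤ 3 / 2 * N := by nlinarith
  have hdiv : ∀ (f : Fin N → ℝ), ∑ i, f (σ i) / m (σ i) = ∑ j, f j := fun f => by
    rw [sum_comp_eq_sum_mul hσ fun j => f j / m j]
    exact Finset.sum_congr rfl fun j _ => mul_div_cancel₀ _ (hm0 j).ne'
  obtain ⟨ε, hε, hbound⟩ := exists_balanced_signs (p := p) hp1 hp2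
    (μ := fun i => μ (σ i) / m (σ i)) (fun i => div_nonneg (hμ _) (hm0 _).le)
    ((hdiv μ).trans_le hμ1) (u := fun i => u (σ i)) (n := n) (by exact_mod_cast hn)
    (fun i => (hu _).trans hd)
    (fun c => (hframe c).trans_eq (by
      rw [← hdiv]
      exact Finset.sum_congr rfl fun i _ => by ring))
    hNR (fun i => by
      rw [div_le_div_iff₀ (hm0 _) (by linarith)]
      linarith [hmμ (σ i)]) (by simpa using hM)
  have hcompl : (Finset.univ.filter fun i => ε i = true)ᶜ
      = Finset.univ.filter fun i => ε i = false := by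
    ext i
    simp
  have hcard : ∀ b, ((Finset.univ.filter fun i => ε i = b).card : ℝ) ≤ 7 / 8 * N := fun b => by
    have h := two_mul_sum_filter_sign_le (f := fun _ => (1 : ℝ)) ε b (B := N / 4)
      (by simpa using hε)
    simp only [Finset.sum_const, Finset.card_univ, Fintype.card_fin, nsmul_eq_mul, mul_one] at h
    linarith
  refine ⟨∑ j, m j, fun i => τ (σ i) / m (σ i), σ, Finset.univ.filter fun i => ε i = true,
    ?_, hM, fun i => div_nonneg (hτ _) (hm0 _).le, (hdiv τ).trans hτ1, fun j => ?_, fun j => ?_,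
    hcard true, hcompl ▸ hcard false, fun x hx S hS => ?_⟩
  · calc N = ∑ _j : Fin N, 1 := by simp
      _ ≤ ∑ j, m j := Finset.sum_le_sum fun j _ => hm1 j
  · obtain ⟨i, hi⟩ := Finset.card_pos.1 ((hm1 j).trans_eq (hσ j).symm)
    exact ⟨i, (Finset.mem_filter.1 hi).2⟩
  · rw [Finset.sum_congr rfl (g := fun _ => τ j / m j) fun i hi => by
      change τ (σ i) / m (σ i) = _
      rw [(Finset.mem_filter.1 hi).2], Finset.sum_const, hσ, nsmul_eq_mul]
    exact mul_div_cancel₀ _ (hm0 j).ne'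
  · set δ := 311401 * (Real.sqrt (n * Real.log n / N) * Real.log n) with hδ
    have hδ0 : 0 ≤ δ := by positivity
    obtain ⟨c, hc⟩ := hV _ (Submodule.mem_map_of_mem hx)
    have hpt : ∀ i, τ (σ i) / m (σ i) * |x (σ i)| ^ p
        = w * (μ (σ i) / m (σ i) * |⟪u (σ i), c⟫| ^ p) := fun i => by
      have := hc (σ i)
      rw [hL] at this
      rw [div_mul_eq_mul_div, this]
      ring
    have htot : ∑ i, τ (σ i) / m (σ i) * |x (σ i)| ^ p
        = w * absMoment (fun i => μ (σ i) / m (σ i)) (fun i => u (σ i)) p c := by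
      rw [absMoment, Finset.mul_sum]
      exact Finset.sum_congr rfl fun i _ => hpt i
    have hsum0 : 0 ≤ ∑ i, τ (σ i) / m (σ i) * |x (σ i)| ^ p :=
      Finset.sum_nonneg fun i _ => mul_nonneg (div_nonneg (hτ _) (hm0 _).le)
        (Real.rpow_nonneg (abs_nonneg _) p)
    have hsigned : |∑ i, sign (ε i) * (τ (σ i) / m (σ i) * |x (σ i)| ^ p)|
        ≤ δ * ∑ i, τ (σ i) / m (σ i) * |x (σ i)| ^ p := by
      rw [htot, Finset.sum_congr rfl fun i _ => by rw [hpt i, mul_left_comm], ← Finset.mul_sum,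
        abs_mul, abs_of_nonneg hw, mul_left_comm δ]
      exact mul_le_mul_of_nonneg_left (hbound c) hw
    have hside : ∀ b, ∑ i ∈ Finset.univ.filter (fun i => ε i = b),
        τ (σ i) / m (σ i) * |x (σ i)| ^ p
          ≤ (1 / 2 + δ) * ∑ i, τ (σ i) / m (σ i) * |x (σ i)| ^ p := fun b => by
      have h := two_mul_sum_filter_sign_le ε b hsigned
      have := mul_nonneg hδ0 hsum0
      linarith
    rcases hS with rfl | hS
    · exact hside true
    · rw [Set.mem_singleton_iff.1 hS, hcompl]
      exact hside false

/-- For small `N` halving the index set is enough. -/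
lemma exists_trivial_splitting {p : ℝ} {N : ℕ} (hN : 2 ≤ N) {τ : Fin N → ℝ} (hτ : ∀ j, 0 ≤ τ j)
    (hτ1 : ∑ j, τ j = 1) :
    ∃ (M : ℕ) (ν : Fin M → ℝ) (σ : Fin M → Fin N) (M₁ : Finset (Fin M)),
      N ≤ M ∧ (M : ℝ) ≤ 3 / 2 * N ∧
      (∀ i, 0 ≤ ν i) ∧ ∑ i, ν i = 1 ∧
      Function.Surjective σ ∧
      (∀ j, ∑ i ∈ Finset.univ.filter (fun i => σ i = j), ν i = τ j) ∧
      (M₁.card : ℝ) ≤ 7 / 8 * N ∧ ((M₁ᶜ : Finset (Fin M)).card : ℝ) ≤ 7 / 8 * N ∧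
      ∀ (x : Fin N → ℝ) (S : Finset (Fin M)),
        ∑ i ∈ S, ν i * |x (σ i)| ^ p ≤ ∑ i, ν i * |x (σ i)| ^ p := by
  obtain ⟨M₁, -, hM₁⟩ := Finset.exists_subset_card_eq (s := (Finset.univ : Finset (Fin N)))
    (n := N / 2) (by simpa using Nat.div_le_self N 2)
  have hNR : (2 : ℝ) ≤ N := by exact_mod_cast hN
  have h1 : ((N / 2 : ℕ) : ℝ) * 2 ≤ N := by exact_mod_cast Nat.div_mul_le_self N 2
  have h2 : (N : ℝ) ≤ 2 * (N / 2 : ℕ) + 1 := by exact_mod_cast (by omega : N ≤ 2 * (N / 2) + 1)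
  refine ⟨N, τ, id, M₁, le_rfl, by linarith, hτ, hτ1, Function.surjective_id, fun j => ?_, ?_, ?_,
    fun x S => ?_⟩
  · simp [Finset.filter_eq']
  · rw [hM₁]
    linarith
  · rw [Finset.card_compl, hM₁, Fintype.card_fin, Nat.cast_sub (Nat.div_le_self N 2)]
    linarith
  · exact Finset.sum_le_sum_of_subset_of_nonneg (Finset.subset_univ S) fun i _ _ =>
      mul_nonneg (hτ i) (Real.rpow_nonneg (abs_nonneg _) p)

lemma sqrt_mul_log_le {p : ℝ} (hp1 : 1 < p) (hp2 : p < 2) {n N : ℕ} (hn : 2 ≤ n) (hnN : n ≤ N) :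
    Real.sqrt (n * Real.log n / N) * Real.log n
      ≤ (p - 1) ^ ((p - 2) / 4) * Real.sqrt ((n : ℝ) / N) *
          Real.log n ^ ((6 - p) / 4) * Real.log N ^ (p / 4) := by
  have hnR : (2 : ℝ) ≤ n := by exact_mod_cast hn
  have hlog : 0 < Real.log n := Real.log_pos (by linarith)
  have hlogN : Real.log n ≤ Real.log N :=
    Real.log_le_log (by linarith) (by exact_mod_cast hnN)
  have h1 : 1 ≤ (p - 1) ^ ((p - 2) / 4) :=
    Real.one_le_rpow_of_pos_of_le_one_of_nonpos (by linarith) (by linarith) (by linarith)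
  have h2 : Real.sqrt (n * Real.log n / N) * Real.log n
      = 1 * Real.sqrt ((n : ℝ) / N) * Real.log n ^ ((6 - p) / 4) * Real.log n ^ (p / 4) := by
    rw [mul_assoc _ (Real.log n ^ _), ← Real.rpow_add hlog,
      show (6 - p) / 4 + p / 4 = 1 / 2 + 1 by ring, Real.rpow_add hlog, Real.rpow_one,
      ← Real.sqrt_eq_rpow, one_mul, ← mul_assoc, ← Real.sqrt_mul (by positivity)]
    congr 2
    ring
  rw [h2]
  gcongr

lemma half_le_sqrt_mul_log {n N : ℕ} (hn : 2 ≤ n) (hnN : n ≤ N) (hN : N ≤ 100) :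
    1 / 2 ≤ 311401 * (Real.sqrt (n * Real.log n / N) * Real.log n) := by
  have hnR : (2 : ℝ) ≤ n := by exact_mod_cast hn
  have hNR : (N : ℝ) ≤ 100 := by exact_mod_cast hN
  have hN0 : (0 : ℝ) < N := by exact_mod_cast (by omega : 0 < N)
  have hlog : 1 / 2 ≤ Real.log n := by
    linarith [Real.log_le_log (by norm_num) hnR, Real.log_two_gt_d9]
  have h1 : (1 / 10 : ℝ) ≤ Real.sqrt (n * Real.log n / N) := by
    refine Real.le_sqrt_of_sq_le ?_
    rw [le_div_iff₀ hN0]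
    nlinarith
  nlinarith

end Splitting

end PartitionBound

/-- Corollary 2.3 (i), case `1 < p < 2`: for an `n`-dimensional subspace `X` of
`L_p(N̄, τ)` (`τ` a probability measure on `{1,…,N}`, `2 ≤ n ≤ N`), there are
`N ≤ M ≤ (3/2)N`, a probability measure `ν` on `M̄ = {1,…,M}`, a partition
`{σ_1,…,σ_N}` of `M̄` (encoded by the surjection `σ : M̄ → N̄`, `i ∈ σ_j ↔ σ i = j`)
with `∑_{i ∈ σ_j} ν{i} = τ{j}` for every `j`, and a partition `M̄ = M₁ ∪ M₂` into
two sets each of cardinality at most `(7/8)N`, such that with `Y = J_p X`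
(`(J_p x)_i = x_{σ i}`), for every `y ∈ Y` and `j = 1, 2`:
`‖1_{M_j} y‖_{L_p(ν)}^p ≤
  (1/2 + C (p-1)^{(p-2)/4} (n/N)^{1/2} (log n)^{(6-p)/4} (log N)^{p/4}) ‖y‖_{L_p(ν)}^p`,
where `C` is an absolute constant. -/
theorem partition_bound_one_lt_p_lt_two :
    ∃ C : ℝ, 0 < C ∧
      ∀ (p : ℝ), 1 < p → p < 2 →
      ∀ (n N : ℕ), 2 ≤ n → n ≤ N →
      ∀ (τ : Fin N → ℝ), (∀ j, 0 ≤ τ j) → ∑ j, τ j = 1 →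
      ∀ (X : Submodule ℝ (Fin N → ℝ)), Module.finrank ℝ X = n →
      ∃ (M : ℕ) (ν : Fin M → ℝ) (σ : Fin M → Fin N) (M₁ : Finset (Fin M)),
        N ≤ M ∧ (M : ℝ) ≤ 3 / 2 * N ∧
        (∀ i, 0 ≤ ν i) ∧ ∑ i, ν i = 1 ∧
        Function.Surjective σ ∧
        (∀ j, ∑ i ∈ Finset.univ.filter (fun i => σ i = j), ν i = τ j) ∧
        (M₁.card : ℝ) ≤ 7 / 8 * N ∧ ((M₁ᶜ : Finset (Fin M)).card : ℝ) ≤ 7 / 8 * N ∧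
        ∀ x ∈ X, ∀ S ∈ ({M₁, M₁ᶜ} : Set (Finset (Fin M))),
          ∑ i ∈ S, ν i * |x (σ i)| ^ p ≤
            (1 / 2 + C * (p - 1) ^ ((p - 2) / 4) * Real.sqrt ((n : ℝ) / N) *
                Real.log n ^ ((6 - p) / 4) * Real.log N ^ (p / 4)) *
              ∑ i, ν i * |x (σ i)| ^ p := by
  refine ⟨311401, by norm_num, fun p hp1 hp2 n N hn hnN τ hτ hτ1 X hX => ?_⟩
  have hle : 311401 * (Real.sqrt (n * Real.log n / N) * Real.log n)
      ≤ 311401 * (p - 1) ^ ((p - 2) / 4) * Real.sqrt ((n : ℝ) / N) *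
          Real.log n ^ ((6 - p) / 4) * Real.log N ^ (p / 4) :=
    (mul_le_mul_of_nonneg_left (PartitionBound.sqrt_mul_log_le hp1 hp2 hn hnN)
      (by norm_num)).trans_eq (by ring)
  rcases le_total 100 N with hN | hN
  · obtain ⟨M, ν, σ, M₁, h1, h2, hν, h3, h4, h5, h6, h7, hbound⟩ :=
      PartitionBound.exists_splitting hp1 hp2 hn hN hτ hτ1 X hX
    refine ⟨M, ν, σ, M₁, h1, h2, hν, h3, h4, h5, h6, h7, fun x hx S hS => ?_⟩
    exact (hbound x hx S hS).trans <| mul_le_mul_of_nonneg_right (by linarith) <|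
      Finset.sum_nonneg fun i _ => mul_nonneg (hν i) (Real.rpow_nonneg (abs_nonneg _) p)
  · obtain ⟨M, ν, σ, M₁, h1, h2, hν, h3, h4, h5, h6, h7, hbound⟩ :=
      PartitionBound.exists_trivial_splitting (p := p) (hn.trans hnN) hτ hτ1
    refine ⟨M, ν, σ, M₁, h1, h2, hν, h3, h4, h5, h6, h7, fun x _ S _ => ?_⟩
    refine (hbound x S).trans (le_mul_of_one_le_left ?_ ?_)
    · exact Finset.sum_nonneg fun i _ =>
        mul_nonneg (hν i) (Real.rpow_nonneg (abs_nonneg _) p)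
    · linarith [PartitionBound.half_le_sqrt_mul_log hn hnN hN]
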